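/- arXiv:2002.06994 — 7 statements merged into one kernel-verified Lean document; each statement's English description precedes it below -/
import Mathlib

section
/- If S ⊆ ℤ is dense in the Bohr topology of ℤ, then there is a subset S′ ⊆ S which is dense in the Bohr topology of ℤ and such that for every m ∈ ℤ, the set (S′ − m) \ {0} is not a set of measurable recurrence. -/
open MeasureTheory Filter Pointwise

/-- The Bohr topology on ℤ: the weakest topology making every group homomorphism
from ℤ to 𝕋 = ℝ/ℤ continuous. -/
noncomputable def bohrTopology : TopologicalSpace ℤ :=
  ⨅ φ : ℤ →+ AddCircle (1 : ℝ), TopologicalSpace.induced (⇑φ) inferInstance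

/-- A set of integers is Bohr dense if it is dense in the Bohr topology of ℤ. -/
def BohrDense (S : Set ℤ) : Prop := @Dense ℤ bohrTopology S

/-- `S ⊆ ℤ` is a set of measurable recurrence if for every invertible
measure preserving transformation `T` of a probability space `(X, μ)` and every
measurable `D ⊆ X` with `μ(D) > 0` there is `n ∈ S` with `D ∩ TⁿD ≠ ∅`. -/
def IsSetOfMeasurableRecurrence (S : Set ℤ) : Prop :=
  ∀ (X : Type) (_ : MeasurableSpace X) (μ : Measure X), IsProbabilityMeasure μ →
    ∀ T : X ≃ᵐ X, MeasurePreserving T μ μ →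
      ∀ D : Set X, MeasurableSet D → 0 < μ D →
        ∃ n ∈ S, (D ∩ ⇑(T.toEquiv ^ n) '' D).Nonempty

/-- `E` is nonrecurrent with a witness set of measure more than `δ`. -/
def NR (δ : ℝ) (E : Set ℤ) : Prop :=
  ∃ (X : Type) (_ : MeasurableSpace X) (μ : Measure X) (T : X ≃ᵐ X) (D : Set X),
    IsProbabilityMeasure μ ∧ MeasurePreserving T μ μ ∧ MeasurableSet D ∧ δ < μ.real D ∧
    ∀ n ∈ E, ∀ x ∈ D, (T.toEquiv ^ n) x ∉ D

lemma NR.mono {δ : ℝ} {E E' : Set ℤ} (h : NR δ E) (hE : E' ⊆ E) : NR δ E' := by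
  obtain ⟨X, _, μ, T, D, h1, h2, h3, h4, h5⟩ := h
  exact ⟨X, _, μ, T, D, h1, h2, h3, h4, fun n hn => h5 n (hE hn)⟩

lemma NR.exists_gt {δ : ℝ} {E : Set ℤ} (h : NR δ E) : ∃ δ' > δ, NR δ' E := by
  obtain ⟨X, _, μ, T, D, h1, h2, h3, h4, h5⟩ := h
  obtain ⟨δ', h6, h7⟩ := exists_between h4
  exact ⟨δ', h6, X, _, μ, T, D, h1, h2, h3, h7, h5⟩

lemma bohr_exists {S : Set ℤ} (hS : BohrDense S) {ι : Type*} [Finite ι]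
    (γ : ι → AddCircle (1 : ℝ)) (n : ℤ) (ε : ι → ℝ) (hε : ∀ i, 0 < ε i) :
    ∃ s ∈ S, ∀ i, ‖(s - n) • γ i‖ < ε i := by
  let _ := bohrTopology
  have hc : ∀ φ : ℤ →+ AddCircle (1 : ℝ), @Continuous _ _ bohrTopology _ φ := fun φ =>
    continuous_iInf_dom (i := φ) continuous_induced_dom
  have hopen : IsOpen {s : ℤ | ∀ i, ‖(s - n) • γ i‖ < ε i} := by
    rw [Set.ofPred_forall]
    refine isOpen_iInter_of_finite fun i => ?_
    have h1 := hc ((zmultiplesHom (AddCircle (1 : ℝ))) (γ i))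
    have : @Continuous _ _ bohrTopology _ (fun s : ℤ => ‖(s - n) • γ i‖) := by
      have h2 : (fun s : ℤ => ‖(s - n) • γ i‖) =
        fun s => ‖(zmultiplesHom (AddCircle (1 : ℝ))) (γ i) s - n • γ i‖ := by
        funext s; simp [sub_smul]
      rw [h2]
      exact (h1.sub continuous_const).norm
    exact isOpen_lt this continuous_const
  have hS' : Dense S := hS
  obtain ⟨s, hs, hs'⟩ := hS'.exists_mem_open hopen ⟨n, by simpa using hε⟩
  exact ⟨s, hs, hs'⟩

lemma bohr_of {S : Set ℤ}
    (h : ∀ (x : ℤ) (l : ℕ) (β : Fin l → AddCircle (1 : ℝ)) (ε : ℝ), 0 < ε →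
      ∃ s ∈ S, ∀ i, ‖(s - x) • β i‖ < ε) : BohrDense S := by
  unfold BohrDense
  let _ := bohrTopology
  intro x
  rw [mem_closure_iff_nhds]
  intro U hU
  have hU2 : U ∈ ⨅ φ : ℤ →+ AddCircle (1 : ℝ), comap φ (nhds (φ x)) := by
    have := hU
    rw [show (bohrTopology : TopologicalSpace ℤ) = ⨅ φ : ℤ →+ AddCircle (1 : ℝ),
      TopologicalSpace.induced (⇑φ) inferInstance from rfl, nhds_iInf] at this
    simpa only [nhds_induced] using this
  have hb : (⨅ φ : ℤ →+ AddCircle (1 : ℝ), comap φ (nhds (φ x))).HasBasis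
      (fun p : Set (ℤ →+ AddCircle (1 : ℝ)) × ((ℤ →+ AddCircle (1 : ℝ)) → ℝ) =>
        p.1.Finite ∧ ∀ i ∈ p.1, 0 < p.2 i)
      (fun p => ⋂ i ∈ p.1, i ⁻¹' Metric.ball (i x) (p.2 i)) :=
    HasBasis.iInf' fun i : ℤ →+ AddCircle (1 : ℝ) => (Metric.nhds_basis_ball (x := i x)).comap (⇑i)
  obtain ⟨⟨I, e⟩, ⟨hI, he⟩, hsub⟩ := hb.mem_iff.1 hU2
  obtain ⟨ε, hε, hε'⟩ : ∃ ε > 0, ∀ i ∈ I, ε ≤ e i := by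
    obtain rfl | hne := I.eq_empty_or_nonempty
    · exact ⟨1, one_pos, by simp⟩
    · obtain ⟨i, hi, hi'⟩ := Set.exists_min_image I e hI hne
      exact ⟨e i, he i hi, hi'⟩
  obtain ⟨l, f, hf⟩ := hI.fin_param
  obtain ⟨s, hs, hs'⟩ := h x l (fun j => f j 1) ε hε
  refine ⟨s, hsub ?_, hs⟩
  simp only [Set.mem_iInter]
  intro φ hφ
  obtain ⟨j, rfl⟩ : φ ∈ Set.range f := hf.2 ▸ hφ
  have := hs' j
  simp only [Set.mem_preimage, Metric.mem_ball, dist_eq_norm]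
  have h3 : f j s - f j x = (s - x) • f j 1 := by
    rw [← map_sub, ← map_zsmul]; simp
  rw [h3]
  exact this.trans_le (hε' _ hφ)

lemma pow_toEquiv_eq {X : Type} [MeasurableSpace X] (T : X ≃ᵐ X) (i : ℕ) (x : X) :
    (T.toEquiv ^ (i : ℤ)) x = (⇑T)^[i] x := by
  rw [zpow_natCast]
  induction i generalizing x with
  | zero => simp
  | succ k ih => rw [pow_succ, Equiv.Perm.mul_apply, ih, Function.iterate_succ_apply]; rfl

lemma NR.window {δ : ℝ} {E : Set ℤ} (h : NR δ E) (L : ℕ) (hL : 0 < L) :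
    ∃ A : Finset ℤ, A ⊆ Finset.Ico 0 (L : ℤ) ∧ δ * L < A.card ∧ ∀ a ∈ A, ∀ e ∈ E, a + e ∉ A := by
  classical
  obtain ⟨X, _, μ, T, D, h1, h2, h3, h4, h5⟩ := h
  have hit : ∀ i : ℕ, MeasurePreserving (⇑T)^[i] μ μ := fun i => h2.iterate i
  set f : X → ℝ := fun x => ∑ i ∈ Finset.range L, ((⇑T)^[i] ⁻¹' D).indicator (fun _ => (1 : ℝ)) x
    with hf
  have hint : ∀ i ∈ Finset.range L,
      Integrable (((⇑T)^[i] ⁻¹' D).indicator (fun _ => (1 : ℝ))) μ := fun i _ =>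
    (integrable_const 1).indicator ((hit i).measurable h3)
  have hI : ∫ x, f x ∂μ = L * μ.real D := by
    rw [hf, integral_finsetSum _ hint]
    simp_rw [fun i => integral_indicator_const (μ := μ) (1 : ℝ) ((hit i).measurable h3)]
    have : ∀ i, μ.real ((⇑T)^[i] ⁻¹' D) = μ.real D := fun i => by
      simp [measureReal_def, (hit i).measure_preimage h3.nullMeasurableSet]
    simp [this]
  have hex : ∃ x, δ * L < f x := by
    by_contra! hcon
    have := integral_mono (μ := μ) (integrable_finsetSum _ hint) (integrable_const (δ * L)) hcon
    rw [hI] at this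
    simp at this
    have hL' : (0 : ℝ) < L := by exact_mod_cast hL
    nlinarith
  obtain ⟨x, hx⟩ := hex
  refine ⟨(Finset.Ico 0 (L : ℤ)).filter (fun a => (T.toEquiv ^ a) x ∈ D),
    Finset.filter_subset _ _, ?_, ?_⟩
  · refine hx.trans_le (le_of_eq ?_)
    rw [hf]
    simp only [Set.indicator_apply, Set.mem_preimage]
    rw [Finset.sum_boole]
    norm_cast
    apply Finset.card_bij (fun (i : ℕ) _ => (i : ℤ))
    · intro i hi
      simp only [Finset.mem_filter, Finset.mem_range, Finset.mem_Ico] at hi ⊢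
      rw [pow_toEquiv_eq]
      exact ⟨by omega, hi.2⟩
    · intro a _ b _ hab; exact_mod_cast hab
    · intro b hb
      simp only [Finset.mem_filter, Finset.mem_range, Finset.mem_Ico] at hb
      lift b to ℕ using hb.1.1
      rw [pow_toEquiv_eq] at hb
      exact ⟨b, by simp only [Finset.mem_filter, Finset.mem_range]; exact ⟨by omega, hb.2⟩, rfl⟩
  · intro a ha e he hae
    simp only [Finset.mem_filter] at ha hae
    apply h5 e he _ ha.2
    rw [← Equiv.Perm.mul_apply, ← zpow_add, add_comm]
    exact hae.2

lemma NR.add_point {δ : ℝ} (hδ : 0 ≤ δ) {E : Set ℤ} (hE : E.Finite) (hne : E.Nonempty)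
    (h : NR δ E) :
    ∃ (N : ℕ) (c : ℤ) (B : Finset (ZMod N)), 4 ≤ N ∧ δ * N < B.card ∧
      (∀ b ∈ B, b + (c : ZMod N) ∉ B) ∧ ∀ e ∈ E, ∀ b ∈ B, b + (e : ZMod N) ∉ B := by
  classical
  obtain ⟨δ', hδ', h'⟩ := h.exists_gt
  obtain ⟨e0, he0⟩ := hne
  obtain ⟨M, hM⟩ : ∃ M : ℕ, ∀ e ∈ E, |e| ≤ M := by
    obtain ⟨M, hM⟩ := (hE.image (fun e : ℤ => e.natAbs)).bddAbove
    refine ⟨M, fun e he => ?_⟩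
    have := hM ⟨e, he, rfl⟩
    simp only at this
    rw [Int.abs_eq_natAbs]
    exact_mod_cast this
  -- choose L large
  obtain ⟨L, hL⟩ := exists_nat_gt ((2 * M * δ) / (δ' - δ))
  have hd : 0 < δ' - δ := by linarith
  rw [div_lt_iff₀ hd] at hL
  set L' := L + 2
  obtain ⟨A, hA, hcard, hfree⟩ := h'.window L' (by omega)
  set c : ℕ := L' + 2 * M with hc
  have hrange : ∀ a ∈ A, 0 ≤ a ∧ a < L' := fun a ha => by
    simpa using hA ha
  let f : ℤ → ZMod (2 * c) := fun a => (a : ZMod (2 * c))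
  have key : ∀ x y : ℤ, (x : ZMod (2 * c)) = y → |x - y| < 2 * c → x = y := by
    intro x y hxy hlt
    rw [ZMod.intCast_eq_intCast_iff_dvd_sub] at hxy
    have := Int.eq_zero_of_abs_lt_dvd hxy (by rw [abs_sub_comm]; push_cast; exact hlt)
    omega
  let g : ℤ → ZMod (2 * c) := fun a => ((a + e0 + c : ℤ) : ZMod (2 * c))
  have hcz : ((2 * c : ℤ) : ZMod (2 * c)) = 0 := by
    exact_mod_cast ZMod.natCast_self (2 * c)
  have he0' := abs_le.1 (hM e0 he0)
  have memB : ∀ z, z ∈ A.image f ∪ A.image g ↔ (∃ a ∈ A, (a : ZMod (2 * c)) = z) ∨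
      ∃ a ∈ A, ((a + e0 + c : ℤ) : ZMod (2 * c)) = z := by
    intro z; simp [f, g]
  refine ⟨2 * c, c, A.image f ∪ A.image g, by omega, ?_, ?_, ?_⟩
  · rw [Finset.card_union_of_disjoint, Finset.card_image_of_injOn, Finset.card_image_of_injOn]
    · push_cast
      have : (L' : ℝ) = L + 2 := by simp [L']
      rw [hc]; push_cast; rw [this] at hcard ⊢
      nlinarith
    · intro a ha b hb hab
      have h1 := hrange a ha; have h2 := hrange b hb
      have := key _ _ hab (by rw [abs_lt]; constructor <;> omega)
      omega
    · intro a ha b hb hab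
      have h1 := hrange a ha; have h2 := hrange b hb
      have := key _ _ hab (by rw [abs_lt]; constructor <;> omega)
      omega
    · rw [Finset.disjoint_left]
      intro z hz hz'
      simp only [Finset.mem_image] at hz hz'
      obtain ⟨a, ha, rfl⟩ := hz
      obtain ⟨b, hb, hab⟩ := hz'
      have h1 := hrange a ha; have h2 := hrange b hb
      have := key _ _ hab (by rw [abs_lt]; constructor <;> omega)
      omega
  · intro b hb hb'
    rw [memB] at hb hb'
    obtain ⟨a, ha, rfl⟩ | ⟨a, ha, rfl⟩ := hb <;> obtain ⟨a', ha', h2⟩ | ⟨a', ha', h2⟩ := hb' <;>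
      have r1 := hrange a ha <;> have r2 := hrange a' ha'
    · rw [← Int.cast_add] at h2
      have := key _ _ h2 (by rw [abs_lt]; constructor <;> omega)
      omega
    · rw [← Int.cast_add] at h2
      have := key _ _ h2 (by rw [abs_lt]; constructor <;> omega)
      exact hfree a' ha' e0 he0 (by rwa [show a' + e0 = a by omega])
    · have h3 : ((a' : ℤ) : ZMod (2 * c)) = ((a + e0 : ℤ) : ZMod (2 * c)) := by
        rw [h2]
        have : ((a + e0 + c : ℤ) : ZMod (2 * c)) + ((c : ℤ) : ZMod (2 * c)) =
          ((a + e0 : ℤ) : ZMod (2 * c)) + ((2 * c : ℤ) : ZMod (2 * c)) := by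
          push_cast; ring
        rw [this, hcz, add_zero]
      have := key _ _ h3 (by rw [abs_lt]; constructor <;> omega)
      exact hfree a ha e0 he0 (by rwa [← this])
    · rw [← Int.cast_add] at h2
      have := key _ _ h2 (by rw [abs_lt]; constructor <;> omega)
      omega
  · intro e he b hb hb'
    have he' := abs_le.1 (hM e he)
    rw [memB] at hb hb'
    obtain ⟨a, ha, rfl⟩ | ⟨a, ha, rfl⟩ := hb <;> obtain ⟨a', ha', h2⟩ | ⟨a', ha', h2⟩ := hb' <;>
      have r1 := hrange a ha <;> have r2 := hrange a' ha' <;>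
      rw [← Int.cast_add] at h2 <;>
      have h3 := key _ _ h2 (by rw [abs_lt]; constructor <;> omega)
    · exact hfree a ha e he (by rwa [← h3])
    · omega
    · omega
    · exact hfree a ha e he (by rwa [show a + e = a' by omega])

lemma int_exp_two_pi (n : ℤ) :
    ∫ θ in (0 : ℝ)..(2 * Real.pi), Complex.exp ((n : ℂ) * Complex.I * θ) =
      if n = 0 then (2 * Real.pi : ℂ) else 0 := by
  split_ifs with h
  · subst h; simp
  · rw [integral_exp_mul_complex (by simpa using h)]
    have : (n : ℂ) * Complex.I * ((2 * Real.pi : ℝ) : ℂ) = n * (2 * Real.pi * Complex.I) := by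
      push_cast; ring
    rw [this, Complex.exp_int_mul_two_pi_mul_I]
    simp

lemma walk_count {α : Type} [Fintype α] (s : α → ℤ) (d : ℕ) (t : ℤ) :
    2 * Real.pi * ((Finset.univ.filter fun a : Fin d → α => ∑ j, s (a j) = t).card : ℝ) ≤
      ∫ θ in (0 : ℝ)..(2 * Real.pi), ‖∑ x, Complex.exp ((s x : ℂ) * Complex.I * θ)‖ ^ d := by
  have h1 : ((2 * Real.pi : ℂ) *
      ((Finset.univ.filter fun a : Fin d → α => ∑ j, s (a j) = t).card : ℂ)) =
      ∫ θ in (0 : ℝ)..(2 * Real.pi), Complex.exp (((-t : ℤ) : ℂ) * Complex.I * θ) *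
        (∑ x, Complex.exp ((s x : ℂ) * Complex.I * θ)) ^ d := by
    have : ∀ θ : ℝ, Complex.exp (((-t : ℤ) : ℂ) * Complex.I * θ) *
        (∑ x, Complex.exp ((s x : ℂ) * Complex.I * θ)) ^ d =
        ∑ a : Fin d → α, Complex.exp (((∑ j, s (a j) - t : ℤ) : ℂ) * Complex.I * θ) := by
      intro θ
      rw [Fintype.sum_pow, Finset.mul_sum]
      refine Finset.sum_congr rfl fun a _ => ?_
      rw [← Complex.exp_sum, ← Complex.exp_add]
      congr 1
      push_cast
      rw [← Finset.sum_mul, ← Finset.sum_mul]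
      ring
    simp_rw [this]
    rw [intervalIntegral.integral_finsetSum]
    · simp_rw [int_exp_two_pi, sub_eq_zero]
      rw [← Finset.sum_filter, Finset.sum_const, nsmul_eq_mul, mul_comm]
    · intro a _
      apply Continuous.intervalIntegrable
      fun_prop
  have h2 : 2 * Real.pi * ((Finset.univ.filter fun a : Fin d → α => ∑ j, s (a j) = t).card : ℝ) =
      ‖((2 * Real.pi : ℂ) *
      ((Finset.univ.filter fun a : Fin d → α => ∑ j, s (a j) = t).card : ℂ))‖ := by
    simp [abs_of_pos Real.pi_pos]
  rw [h2, h1]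
  refine (intervalIntegral.norm_integral_le_integral_norm Real.two_pi_pos.le).trans (le_of_eq ?_)
  congr 1
  funext θ
  rw [norm_mul, norm_pow]
  have : (((-t : ℤ) : ℂ) * Complex.I * θ) = ((-t * θ : ℝ) : ℂ) * Complex.I := by
    push_cast; ring
  rw [this, Complex.norm_exp_ofReal_mul_I, one_mul]

lemma walk_tendsto {α : Type} [Fintype α] [Nonempty α] (s : α → ℤ) (t : ℤ)
    (hs : ∀ θ ∈ Set.Ioo (0 : ℝ) (2 * Real.pi),
      ‖∑ x, Complex.exp ((s x : ℂ) * Complex.I * θ)‖ < Fintype.card α) :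
    Tendsto (fun d : ℕ =>
      ((Finset.univ.filter fun a : Fin d → α => ∑ j, s (a j) = t).card : ℝ) /
        (Fintype.card α : ℝ) ^ d) atTop (nhds 0) := by
  have hc : (0 : ℝ) < Fintype.card α := by exact_mod_cast Fintype.card_pos
  have h1 : Tendsto (fun d : ℕ => ∫ θ in (0 : ℝ)..(2 * Real.pi),
      (‖∑ x, Complex.exp ((s x : ℂ) * Complex.I * θ)‖ / Fintype.card α) ^ d) atTop
      (nhds (∫ θ in (0 : ℝ)..(2 * Real.pi), (0 : ℝ))) := by
    simp_rw [intervalIntegral.integral_of_le Real.two_pi_pos.le, integral_Ioc_eq_integral_Ioo]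
    apply tendsto_integral_of_dominated_convergence (fun _ => (1 : ℝ))
    · intro n
      apply Continuous.aestronglyMeasurable
      fun_prop
    · exact integrable_const _
    · intro n
      refine (ae_restrict_iff' measurableSet_Ioo).2 (Eventually.of_forall fun θ hθ => ?_)
      rw [norm_pow]
      apply pow_le_one₀ (norm_nonneg _)
      rw [Real.norm_of_nonneg (by positivity), div_le_one hc]
      exact (hs θ hθ).le
    · refine (ae_restrict_iff' measurableSet_Ioo).2 (Eventually.of_forall fun θ hθ => ?_)
      apply tendsto_pow_atTop_nhds_zero_of_lt_one (by positivity)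
      rw [div_lt_one hc]
      exact hs θ hθ
  rw [intervalIntegral.integral_zero] at h1
  have h2 := h1.const_mul (1 / (2 * Real.pi))
  rw [mul_zero] at h2
  refine squeeze_zero (fun d => by positivity) (fun d => ?_) h2
  have h3 := walk_count s d t
  simp_rw [div_pow]
  rw [intervalIntegral.integral_div, div_le_iff₀ (by positivity)]
  have := Real.pi_pos
  field_simp
  linarith

/-- number of occurrences of `i` -/
def cnt {N d : ℕ} (a : Fin d → ZMod N) (i : ZMod N) : ℕ :=
  (Finset.univ.filter fun j => a j = i).card

def GG {N d : ℕ} (k : ℕ) (i : ZMod N) : Set (Fin d → ZMod N) :=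
  {a | ∀ i' ≠ i, cnt a i' + 2 * k < cnt a i}

lemma cnt_shift {N d : ℕ} (a : Fin d → ZMod N) (i v : ZMod N) :
    cnt (fun j => a j + v) (i + v) = cnt a i := by
  simp [cnt]

lemma GG_shift {N d : ℕ} (k : ℕ) (a : Fin d → ZMod N) (i v : ZMod N) (h : a ∈ GG k i) :
    (fun j => a j + v) ∈ GG k (i + v) := by
  intro i' hi'
  have := h (i' - v) (fun h => hi' (by rw [← h]; ring))
  rw [← cnt_shift a i v, ← cnt_shift a (i' - v) v, sub_add_cancel] at this
  exact this

lemma cnt_near {N d : ℕ} (k : ℕ) (a a' : Fin d → ZMod N) (i : ZMod N)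
    (h : (Finset.univ.filter fun j => a j ≠ a' j).card ≤ k) : cnt a i ≤ cnt a' i + k := by
  unfold cnt
  refine le_trans (Finset.card_le_card ?_) ((Finset.card_union_le _ _).trans
    (Nat.add_le_add_left h _))
  intro j hj
  simp only [Finset.mem_union, Finset.mem_filter, Finset.mem_univ, true_and] at hj ⊢
  by_cases h : a j = a' j
  · left; rw [← h, hj]
  · right; exact h

lemma GG_near {N d : ℕ} (k : ℕ) (a a' : Fin d → ZMod N) (i i' : ZMod N)
    (h : (Finset.univ.filter fun j => a j ≠ a' j).card ≤ k) (ha : a ∈ GG k i)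
    (ha' : a' ∈ GG k i') : i' = i := by
  by_contra hne
  have h1 := ha i' hne
  have h2 := ha' i (Ne.symm hne)
  have h3 := cnt_near k a a' i h
  have h4 := cnt_near k a' a i' (by simpa only [ne_comm] using h)
  omega

lemma cnt_tendsto {N : ℕ} [NeZero N] (hN : 4 ≤ N) (i i' : ZMod N) (hi : i ≠ i') (t : ℤ) :
    Tendsto (fun d : ℕ =>
      ((Finset.univ.filter fun a : Fin d → ZMod N => (cnt a i : ℤ) - cnt a i' = t).card : ℝ) /
        (N : ℝ) ^ d) atTop (nhds 0) := by
  have := walk_tendsto (α := ZMod N) (fun x => (if x = i then 1 else 0) - (if x = i' then 1 else 0))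
    t ?_
  · rw [ZMod.card] at this
    refine this.congr fun d => ?_
    congr 4
    funext a
    simp [cnt, Finset.sum_boole]
  · intro θ hθ
    rw [ZMod.card]
    have h1 : ∀ x : ZMod N, Complex.exp ((((if x = i then 1 else 0) - (if x = i' then 1 else 0) : ℤ)
        : ℂ) * Complex.I * θ) = 1 + (if x = i then (Complex.exp (Complex.I * θ) - 1) else 0) +
          (if x = i' then (Complex.exp (-(Complex.I * θ)) - 1) else 0) := by
      intro x
      by_cases h : x = i
      · subst h; simp [hi]
      · by_cases h' : x = i'
        · subst h'; simp [h]
        · simp [h, h']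
    simp_rw [h1]
    rw [Finset.sum_add_distrib, Finset.sum_add_distrib]
    simp only [Finset.sum_const, Finset.card_univ, ZMod.card, nsmul_eq_mul, mul_one,
      Finset.sum_ite_eq', Finset.mem_univ, if_true]
    have h2 : (N : ℂ) + (Complex.exp (Complex.I * θ) - 1) + (Complex.exp (-(Complex.I * θ)) - 1) =
        ((N - 2 + 2 * Real.cos θ : ℝ) : ℂ) := by
      push_cast
      rw [Complex.two_cos]
      rw [mul_comm Complex.I]
      ring_nf
    rw [h2, Complex.norm_real, Real.norm_eq_abs, abs_lt]
    have hN' : (4 : ℝ) ≤ N := by exact_mod_cast hN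
    have h3 := Real.neg_one_le_cos θ
    have h4 : Real.cos θ < 1 := by
      refine lt_of_le_of_ne (Real.cos_le_one θ) fun h => ?_
      have := (Real.cos_eq_one_iff_of_lt_of_lt (by linarith [hθ.1, Real.pi_pos]) hθ.2).1 h
      linarith [hθ.1]
    constructor <;> linarith

open Classical in
lemma vote {N : ℕ} (hN : 4 ≤ N) (B : Finset (ZMod N)) (δ : ℝ) (hδ : δ * N < B.card) (k : ℕ) :
    ∃ d : ℕ, δ * (N : ℝ) ^ d <
      (Set.ncard {a : Fin d → ZMod N | ∃ i ∈ B, a ∈ GG k i} : ℝ) := by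
  have : NeZero N := ⟨by omega⟩
  have hN' : (0 : ℝ) < N := by exact_mod_cast (by omega : 0 < N)
  let P : Finset ((ZMod N × ZMod N) × ℤ) :=
    (Finset.univ.filter fun p : ZMod N × ZMod N => p.1 ≠ p.2) ×ˢ Finset.Icc (-(2 * k : ℤ)) (2 * k)
  have ht : Tendsto (fun d : ℕ => ∑ p ∈ P,
      ((Finset.univ.filter fun a : Fin d → ZMod N => (cnt a p.1.1 : ℤ) - cnt a p.1.2 = p.2).card : ℝ) /
        (N : ℝ) ^ d) atTop (nhds 0) := by
    rw [← Finset.sum_const_zero (s := P)]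
    refine tendsto_finsetSum _ fun p hp => cnt_tendsto hN _ _ ?_ _
    simp only [P, Finset.mem_product, Finset.mem_filter] at hp
    exact hp.1.2
  -- choose d
  have hex : ∃ d : ℕ, δ * N < B.card * (1 - ∑ p ∈ P,
      ((Finset.univ.filter fun a : Fin d → ZMod N => (cnt a p.1.1 : ℤ) - cnt a p.1.2 = p.2).card : ℝ) /
        (N : ℝ) ^ d) := by
    have h1 := (ht.const_sub 1).const_mul (B.card : ℝ)
    rw [sub_zero, mul_one] at h1
    exact (h1.eventually (lt_mem_nhds hδ)).exists
  obtain ⟨d, hd⟩ := hex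
  refine ⟨d, ?_⟩
  let G : ZMod N → Finset (Fin d → ZMod N) := fun i => Finset.univ.filter fun a => a ∈ GG k i
  have hdisj : ∀ s : Finset (ZMod N), (s.biUnion G).card = s.card * (G 0).card := by
    intro s
    rw [Finset.card_biUnion]
    · rw [Finset.sum_congr rfl (g := fun _ => (G 0).card), Finset.sum_const, smul_eq_mul]
      intro i _
      apply le_antisymm
      · refine Finset.card_le_card_of_injOn (fun a j => a j + (-i)) ?_ ?_
        · intro a ha
          simp only [G, Finset.coe_filter, Finset.mem_univ, true_and] at ha ⊢
          have := GG_shift k a i (-i) ha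
          rwa [add_neg_cancel] at this
        · intro a _ b _ hab
          funext j
          simpa using congrFun hab j
      · refine Finset.card_le_card_of_injOn (fun a j => a j + i) ?_ ?_
        · intro a ha
          simp only [G, Finset.coe_filter, Finset.mem_univ, true_and] at ha ⊢
          have := GG_shift k a 0 i ha
          rwa [zero_add] at this
        · intro a _ b _ hab
          funext j
          simpa using congrFun hab j
    · intro i _ i' _ hne
      rw [Function.onFun, Finset.disjoint_left]
      intro a ha ha'
      simp only [G, Finset.mem_filter, Finset.mem_univ, true_and] at ha ha'
      exact hne (GG_near k a a i i' (by simp) ha ha').symm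
  have hset : {a : Fin d → ZMod N | ∃ i ∈ B, a ∈ GG k i} = (B.biUnion G : Finset _) := by
    ext a; simp [G]
  rw [hset, Set.ncard_coe_finset, hdisj]
  have hcov : (Finset.univ : Finset (Fin d → ZMod N)) ⊆ (Finset.univ.biUnion G) ∪ P.biUnion fun p =>
      Finset.univ.filter fun a : Fin d → ZMod N => (cnt a p.1.1 : ℤ) - cnt a p.1.2 = p.2 := by
    intro a _
    by_cases h : ∃ i, a ∈ GG k i
    · apply Finset.mem_union_left
      obtain ⟨i, hi⟩ := h
      simp only [G, Finset.mem_biUnion, Finset.mem_filter, Finset.mem_univ, true_and]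
      exact ⟨i, hi⟩
    · apply Finset.mem_union_right
      push Not at h
      obtain ⟨i, hi⟩ := Finite.exists_max (cnt a)
      have h2 := h i
      simp only [GG, Set.mem_ofPred_eq] at h2
      push Not at h2
      obtain ⟨i', hne, hi'⟩ := h2
      simp only [P, Finset.mem_biUnion, Finset.mem_product, Finset.mem_filter, Finset.mem_univ,
        true_and, Finset.mem_Icc]
      refine ⟨⟨(i, i'), (cnt a i : ℤ) - cnt a i'⟩, ⟨hne.symm, ?_, ?_⟩, rfl⟩ <;>
        have := hi i' <;> simp only <;> omega
  have hcard := (Finset.card_le_card hcov).trans ((Finset.card_union_le _ _).trans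
    (Nat.add_le_add_left Finset.card_biUnion_le _))
  rw [hdisj, Finset.card_univ, Finset.card_univ, Fintype.card_fun, ZMod.card, Fintype.card_fin] at hcard
  have hcard' : (N : ℝ) ^ d ≤ N * (G 0).card + ∑ p ∈ P,
      ((Finset.univ.filter fun a : Fin d → ZMod N =>
        (cnt a p.1.1 : ℤ) - cnt a p.1.2 = p.2).card : ℝ) := by
    exact_mod_cast hcard
  rw [← Finset.sum_div] at hd
  set SS := ∑ p ∈ P, ((Finset.univ.filter fun a : Fin d → ZMod N =>
        (cnt a p.1.1 : ℤ) - cnt a p.1.2 = p.2).card : ℝ)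
  have hpow : (0 : ℝ) < (N : ℝ) ^ d := by positivity
  have h5 : δ * N * (N : ℝ) ^ d < B.card * ((N : ℝ) ^ d - SS) := by
    have := mul_lt_mul_of_pos_right hd hpow
    rw [mul_assoc (B.card : ℝ), sub_mul, one_mul, div_mul_cancel₀ _ hpow.ne'] at this
    exact this
  have h6 : (B.card : ℝ) * ((N : ℝ) ^ d - SS) ≤ B.card * (N * (G 0).card) := by
    apply mul_le_mul_of_nonneg_left _ (Nat.cast_nonneg _)
    linarith
  push_cast
  have h7 : N * (δ * (N : ℝ) ^ d) < N * (B.card * (G 0).card) := by nlinarith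
  exact lt_of_mul_lt_mul_left h7 hN'.le

noncomputable def ctr {N : ℕ} (x : ZMod N) : AddCircle (1 : ℝ) := ((((x.val : ℝ) + 1 / 2) / N : ℝ) : AddCircle (1 : ℝ))

lemma cell {N : ℕ} [NeZero N] {ρ : ℝ} (x x' : ZMod N) (v : ℤ) (y y' : AddCircle (1 : ℝ))
    (hy : y ∈ Metric.closedBall (ctr x) ρ) (hy' : y' ∈ Metric.closedBall (ctr x') ρ)
    (h : ‖y' - y - ((v / N : ℝ) : AddCircle (1 : ℝ))‖ < 1 / N - 2 * ρ) : x' = x + v := by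
  have hN : (0 : ℝ) < N := by exact_mod_cast Nat.pos_of_ne_zero (NeZero.ne N)
  rw [Metric.mem_closedBall, dist_eq_norm] at hy hy'
  have h1 : ‖ctr x' - ctr x - ((v / N : ℝ) : AddCircle (1 : ℝ))‖ < 1 / N := by
    have : ctr x' - ctr x - ((v / N : ℝ) : AddCircle (1 : ℝ)) =
      (y' - y - ((v / N : ℝ) : AddCircle (1 : ℝ))) - (y' - ctr x') + (y - ctr x) := by abel
    rw [this]
    have h2 := norm_add_le ((y' - y - ((v / N : ℝ) : AddCircle (1 : ℝ))) - (y' - ctr x')) (y - ctr x)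
    have h3 := norm_sub_le (y' - y - ((v / N : ℝ) : AddCircle (1 : ℝ))) (y' - ctr x')
    linarith
  set m : ℤ := (x'.val : ℤ) - x.val - v with hm
  have h2 : ctr x' - ctr x - ((v / N : ℝ) : AddCircle (1 : ℝ)) =
      ((m / N : ℝ) : AddCircle (1 : ℝ)) := by
    unfold ctr
    rw [← AddCircle.coe_sub, ← AddCircle.coe_sub]
    congr 1
    rw [hm]; push_cast; field_simp; ring
  rw [h2, UnitAddCircle.norm_eq] at h1
  set r := round ((m : ℝ) / N)
  have h3 : |((m - r * N : ℤ) : ℝ)| < 1 := by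
    have : ((m - r * N : ℤ) : ℝ) = (m / N - r) * N := by push_cast; field_simp
    rw [this, abs_mul, abs_of_pos hN]
    rwa [lt_div_iff₀ hN] at h1
  have h4 : m - r * N = 0 := by
    have : |m - r * N| < 1 := by exact_mod_cast h3
    exact Int.abs_lt_one_iff.1 this
  have h5 : ((m : ℤ) : ZMod N) = 0 := by
    rw [show m = r * N by omega]; simp
  rw [hm] at h5
  push_cast at h5
  rw [ZMod.natCast_zmod_val, ZMod.natCast_zmod_val, sub_sub, sub_eq_zero] at h5
  exact h5

lemma addRight_zpow {G : Type} [AddCommGroup G] [MeasurableSpace G] [MeasurableAdd G] (α : G)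
    (n : ℤ) (y : G) : ((MeasurableEquiv.addRight α).toEquiv ^ n) y = y + n • α := by
  induction n using Int.induction_on generalizing y with
  | zero => simp
  | succ k ih =>
    rw [zpow_add_one, Equiv.Perm.mul_apply, ih]
    change y + α + _ = _
    rw [add_smul, one_smul]; abel
  | pred k ih =>
    rw [zpow_sub_one, Equiv.Perm.mul_apply, ih]
    change y + -α + _ = _
    rw [sub_smul, one_smul]; abel

lemma system {N : ℕ} (hN : 4 ≤ N) (B : Finset (ZMod N)) (δ : ℝ) 
    (hδ : δ * N < B.card) (k : ℕ) :
    ∃ d : ℕ, ∃ τ > 0, ∀ α : Fin d → AddCircle (1 : ℝ),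
      NR δ {n : ℤ | ∃ v : ℤ, (∀ b ∈ B, b + (v : ZMod N) ∉ B) ∧
        Set.ncard {j | ¬ ‖n • α j - ((v / N : ℝ) : AddCircle (1 : ℝ))‖ < τ} ≤ k} := by
  classical
  have : NeZero N := ⟨by omega⟩
  have hN0 : (0 : ℝ) < N := by exact_mod_cast (by omega : 0 < N)
  obtain ⟨d, hd⟩ := vote hN B δ hδ k
  set W := {a : Fin d → ZMod N | ∃ i ∈ B, a ∈ GG k i} with hW
  -- choose ρ
  obtain ⟨ρ, hρ0, hρN, hρ⟩ : ∃ ρ : ℝ, 0 < ρ ∧ ρ < 1 / (2 * N) ∧ δ < (W.ncard : ℝ) * (2 * ρ) ^ d := by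
    have hc : Tendsto (fun ρ : ℝ => (W.ncard : ℝ) * (2 * ρ) ^ d) (nhdsWithin (1 / (2 * N)) (Set.Iio (1 / (2 * N : ℝ))))
        (nhds ((W.ncard : ℝ) * (2 * (1 / (2 * N))) ^ d)) := by
      apply Tendsto.mono_left _ nhdsWithin_le_nhds
      apply Continuous.tendsto
      fun_prop
    have hlt : δ < (W.ncard : ℝ) * (2 * (1 / (2 * N))) ^ d := by
      rw [show (2 * (1 / (2 * (N : ℝ)))) = (N : ℝ)⁻¹ by field_simp, inv_pow, ← div_eq_mul_inv,
        lt_div_iff₀ (by positivity)]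
      exact hd
    have h1 := hc.eventually (lt_mem_nhds hlt)
    have h2 : ∀ᶠ ρ in nhdsWithin (1 / (2 * N : ℝ)) (Set.Iio (1 / (2 * N : ℝ))), 0 < ρ :=
      nhdsWithin_le_nhds (lt_mem_nhds (by positivity))
    obtain ⟨ρ, h3, h4, h5⟩ := (h1.and (h2.and self_mem_nhdsWithin)).exists
    exact ⟨ρ, h4, h5, h3⟩
  have hρN' : 0 < 1 / N - 2 * ρ := by
    have : 1 / (2 * (N : ℝ)) = 1 / N / 2 := by field_simp
    linarith
  refine ⟨d, 1 / N - 2 * ρ, hρN', fun α => ?_⟩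
  have hprob : IsProbabilityMeasure (volume : Measure (AddCircle (1 : ℝ))) :=
    ⟨by simp [AddCircle.measure_univ]⟩
  let D : Set (Fin d → AddCircle (1 : ℝ)) :=
    ⋃ a ∈ W, Set.pi Set.univ fun j => Metric.closedBall (ctr (a j)) ρ
  have hmeas : ∀ a ∈ W, MeasurableSet (Set.pi Set.univ fun j => Metric.closedBall (ctr (a j)) ρ) :=
    fun a _ => MeasurableSet.univ_pi fun j => Metric.isClosed_closedBall.measurableSet
  refine ⟨Fin d → AddCircle (1 : ℝ), inferInstance, volume, MeasurableEquiv.addRight α, D,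
    ?_, ?_, ?_, ?_, ?_⟩
  · exact Measure.pi.instIsProbabilityMeasure _
  · exact measurePreserving_add_right volume α
  · exact MeasurableSet.biUnion (Set.to_countable _) hmeas
  · have hvol : volume D = ENNReal.ofReal ((W.ncard : ℝ) * (2 * ρ) ^ d) := by
      rw [measure_biUnion (Set.to_countable _) _ hmeas]
      · have : ∀ a : W, volume (Set.pi Set.univ fun j => Metric.closedBall (ctr (a.1 j)) ρ) =
            ENNReal.ofReal (2 * ρ) ^ d := by
          intro a
          rw [volume_pi_pi]
          simp_rw [AddCircle.volume_closedBall]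
          rw [min_eq_right, Finset.prod_const, Finset.card_univ, Fintype.card_fin]
          have : 1 / (N : ℝ) ≤ 1 := by
            rw [div_le_one hN0]; exact_mod_cast (by omega : 1 ≤ N)
          linarith
        simp_rw [this]
        rw [tsum_fintype, Finset.sum_const, Finset.card_univ, nsmul_eq_mul, ENNReal.ofReal_mul (p := (W.ncard : ℝ)) (Nat.cast_nonneg _),
          ENNReal.ofReal_pow (by positivity), ENNReal.ofReal_natCast, Set.ncard_eq_toFinset_card',
          Set.toFinset_card]
      · intro a _ b _ hab
        rw [Function.onFun, Set.disjoint_left]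
        intro y hy hy'
        apply hab
        funext j
        have := cell (ρ := ρ) (a j) (b j) 0 (y j) (y j) (hy j trivial) (hy' j trivial)
          (by simpa using hρN')
        simpa using this.symm
    rw [measureReal_def, hvol, ENNReal.toReal_ofReal (by positivity)]
    exact hρ
  · rintro n ⟨v, hv, hn⟩ y hy hy'
    rw [addRight_zpow] at hy'
    simp only [D, Set.mem_iUnion] at hy hy'
    obtain ⟨a, ⟨i, hi, ha⟩, hy⟩ := hy
    obtain ⟨a', ⟨i', hi', ha'⟩, hy'⟩ := hy'
    have hs := GG_shift k a i v ha
    have : i' = i + v := by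
      refine GG_near k _ a' _ i' ?_ hs ha'
      refine le_trans ?_ hn
      rw [Set.ncard_eq_toFinset_card']
      apply Finset.card_le_card
      intro j hj
      simp only [Finset.mem_filter, Finset.mem_univ, true_and, Set.mem_toFinset, Set.mem_ofPred_eq] at hj ⊢
      intro hlt
      apply hj
      refine (cell (ρ := ρ) (a j) (a' j) v (y j) (y j + n • α j) (hy j trivial) (hy' j trivial) ?_).symm
      simpa using hlt
    exact hv i hi (this ▸ hi')

lemma mFourier_eq_toCircle {K : Type} [Fintype K] (p : K → ℤ) (x : K → AddCircle (1 : ℝ)) :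
    (UnitAddTorus.mFourier p : C(UnitAddTorus K, ℂ)) x =
      (AddCircle.toCircle (∑ i, p i • x i) : ℂ) := by
  have h : ∀ s : Finset K, ((AddCircle.toCircle (∑ i ∈ s, p i • x i) : Circle) : ℂ) =
      ∏ i ∈ s, fourier (p i) (x i) := by
    classical
    intro s
    induction s using Finset.induction_on with
    | empty => simp
    | insert a s ha ih =>
      rw [Finset.sum_insert ha, Finset.prod_insert ha, AddCircle.toCircle_add, Circle.coe_mul, ih,
        fourier_apply]
  exact (h Finset.univ).symm

lemma measure_eq_of_mFourier {K : Type} [Fintype K] {P P' : Measure (K → AddCircle (1 : ℝ))}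
    [IsFiniteMeasure P] [IsFiniteMeasure P']
    (h : ∀ p : K → ℤ, ∫ x, (UnitAddTorus.mFourier p : C(UnitAddTorus K, ℂ)) x ∂P =
      ∫ x, (UnitAddTorus.mFourier p : C(UnitAddTorus K, ℂ)) x ∂P') : P = P' := by
  refine ext_of_forall_mem_subalgebra_integral_eq_of_polish (𝕜 := ℂ)
    (A := (UnitAddTorus.mFourierSubalgebra K).comap
      (BoundedContinuousFunction.toContinuousMapStarₐ (α := K → AddCircle (1 : ℝ)) ℂ)) ?_ ?_
  · intro x y hxy
    obtain ⟨f, ⟨g, hg, rfl⟩, hf⟩ := UnitAddTorus.mFourierSubalgebra_separatesPoints (d := K) hxy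
    refine ⟨g, ⟨g, ⟨BoundedContinuousFunction.mkOfCompact g, ?_, ?_⟩, rfl⟩, hf⟩
    · exact hg
    · rfl
  · intro g hg
    have hg' : (g.toContinuousMap : C(UnitAddTorus K, ℂ)) ∈
        Submodule.span ℂ (Set.range UnitAddTorus.mFourier) := by
      rw [← UnitAddTorus.mFourierSubalgebra_coe]
      exact hg
    have key : ∀ f ∈ Submodule.span ℂ (Set.range (UnitAddTorus.mFourier (d := K))),
        ∫ x, f x ∂P = ∫ x, f x ∂P' := by
      intro f hf
      have hint : ∀ (Q : Measure (K → AddCircle (1 : ℝ))) [IsFiniteMeasure Q]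
        (f : C(UnitAddTorus K, ℂ)), Integrable (fun x => f x) Q := fun Q _ f =>
          f.continuous.integrable_of_hasCompactSupport (HasCompactSupport.of_compactSpace _)
      induction hf using Submodule.span_induction with
      | mem f hf => obtain ⟨p, rfl⟩ := hf; exact h p
      | zero => simp
      | add f g _ _ h1 h2 =>
        simp only [ContinuousMap.add_apply]
        rw [integral_add (hint P f) (hint P g), integral_add (hint P' f) (hint P' g), h1, h2]
      | smul c f _ h1 =>
        simp only [ContinuousMap.smul_apply]
        rw [integral_smul, integral_smul, h1]
    exact key _ hg'

lemma kronecker {K : Type} [Fintype K] (γ u : K → AddCircle (1 : ℝ))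
    (h : ∀ p : K → ℤ, ∑ i, p i • γ i = 0 → ∑ i, p i • u i = 0) :
    u ∈ (AddSubgroup.zmultiples γ).topologicalClosure := by
  set H := (AddSubgroup.zmultiples γ).topologicalClosure with hH
  have hHc : IsClosed (H : Set (K → AddCircle (1 : ℝ))) :=
    AddSubgroup.isClosed_topologicalClosure _
  have hcomp : CompactSpace H := isCompact_iff_compactSpace.1 hHc.isCompact
  let μ : Measure H := Measure.addHaar
  let ν : Measure (K → AddCircle (1 : ℝ)) := μ.map Subtype.val
  have hγ : γ ∈ H := AddSubgroup.le_topologicalClosure _ (AddSubgroup.mem_zmultiples γ)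
  have hfin : IsFiniteMeasure μ := inferInstance
  have hνfin : IsFiniteMeasure ν := Measure.isFiniteMeasure_map _ _
  have hinv : ∀ f : C(K → AddCircle (1 : ℝ), ℂ), ∫ x, f (x + γ) ∂ν = ∫ x, f x ∂ν := by
    intro f
    rw [integral_map (by fun_prop) (by fun_prop), integral_map (by fun_prop) (by fun_prop)]
    exact integral_add_right_eq_self (μ := μ) (fun x : H => f x) ⟨γ, hγ⟩
  have hadd : ∀ (p : K → ℤ) (x y : K → AddCircle (1 : ℝ)),
      (UnitAddTorus.mFourier p : C(UnitAddTorus K, ℂ)) (x + y) =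
      (UnitAddTorus.mFourier p : C(UnitAddTorus K, ℂ)) x *
      (UnitAddTorus.mFourier p : C(UnitAddTorus K, ℂ)) y := by
    intro p x y
    rw [mFourier_eq_toCircle, mFourier_eq_toCircle, mFourier_eq_toCircle, ← Circle.coe_mul,
      ← AddCircle.toCircle_add, ← Finset.sum_add_distrib]
    simp
  have hν : ν.map (· + u) = ν := by
    have : IsFiniteMeasure (ν.map (· + u)) := Measure.isFiniteMeasure_map _ _
    apply measure_eq_of_mFourier
    intro p
    rw [integral_map (by fun_prop) (by fun_prop)]
    simp_rw [hadd]
    rw [integral_mul_const]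
    by_cases hp : ∑ i, p i • γ i = 0
    · rw [mFourier_eq_toCircle p u, h p hp]
      simp
    · have h1 := hinv (UnitAddTorus.mFourier p : C(UnitAddTorus K, ℂ))
      simp_rw [hadd] at h1
      rw [integral_mul_const] at h1
      have h2 : (UnitAddTorus.mFourier p : C(UnitAddTorus K, ℂ)) γ ≠ 1 := by
        rw [mFourier_eq_toCircle]
        intro h3
        apply hp
        apply AddCircle.injective_toCircle one_ne_zero
        rw [AddCircle.toCircle_zero]
        exact Circle.ext (by simpa using h3)
      have h3 : ∫ x, (UnitAddTorus.mFourier p : C(UnitAddTorus K, ℂ)) x ∂ν = 0 := by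
        by_contra h4
        exact h2 (mul_left_cancel₀ h4 (by rw [h1, mul_one]))
      rw [h3, zero_mul]
  have hm : MeasurableSet (H : Set (K → AddCircle (1 : ℝ))) := hHc.measurableSet
  have h1 : ν {x | x + u ∈ H} ≠ 0 := by
    have : ν {x | x + u ∈ H} = (ν.map (· + u)) H := by
      rw [Measure.map_apply (by fun_prop) hm]; rfl
    rw [this, hν, Measure.map_apply measurable_subtype_coe hm]
    have : (Subtype.val ⁻¹' (H : Set (K → AddCircle (1 : ℝ))) : Set H) = Set.univ := by
      ext x; simp
    rw [this]
    exact (isOpen_univ.measure_pos μ Set.univ_nonempty).ne'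
  have hm2 : MeasurableSet {x | x + u ∈ H} := (measurable_add_const u) hm
  rw [Measure.map_apply measurable_subtype_coe hm2] at h1
  obtain ⟨x, hx⟩ := nonempty_of_measure_ne_zero h1
  have := H.sub_mem hx x.2
  simpa using this

lemma hamming {ι : Type} [Fintype ι] (a : ι → ℝ)
    (ha : LinearIndependent ℚ (fun o : Option ι => o.elim (1 : ℝ) a)) (k : ℕ)
    (β : Fin k → AddCircle (1 : ℝ)) (w : ι → AddCircle (1 : ℝ)) (ε : ℝ) (hε : 0 < ε) :
    ∃ n : ℤ, (∀ i, ‖n • β i‖ < ε) ∧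
      Set.ncard {j | ¬ ‖n • (a j : AddCircle (1 : ℝ)) - w j‖ < ε} ≤ k := by
  classical
  choose b hb using fun i => QuotientAddGroup.mk_surjective (β i)
  let W : Submodule ℚ ℝ := Submodule.span ℚ (Set.range (fun o : Option (Fin k) => o.elim (1 : ℝ) b))
  have hW : ∀ o : Option (Fin k), o.elim (1 : ℝ) b ∈ W := fun o =>
    Submodule.subset_span ⟨o, rfl⟩
  obtain ⟨κ, f, hf, hspan, hli⟩ := exists_linearIndependent' ℚ (fun j => W.mkQ (a j))
  have : Finite κ := Finite.of_injective f hf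
  have := Fintype.ofFinite κ
  have hcard : Fintype.card ι ≤ k + Fintype.card κ := by
    have h1 : Set.range (fun o : Option ι => o.elim (1 : ℝ) a) ≤
        Submodule.span ℚ (Set.range (fun o : Option (Fin k) ⊕ κ =>
          Sum.elim (fun o : Option (Fin k) => o.elim (1 : ℝ) b) (a ∘ f) o)) := by
      have hWle : W ≤ Submodule.span ℚ (Set.range (fun o : Option (Fin k) ⊕ κ =>
          Sum.elim (fun o : Option (Fin k) => o.elim (1 : ℝ) b) (a ∘ f) o)) := by
        apply Submodule.span_mono
        rintro _ ⟨o, rfl⟩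
        exact ⟨Sum.inl o, rfl⟩
      rintro _ ⟨o, rfl⟩
      cases o with
      | none => exact hWle (hW none)
      | some j =>
        have h2 : W.mkQ (a j) ∈ Submodule.span ℚ (Set.range ((fun j => W.mkQ (a j)) ∘ f)) := by
          rw [hspan]; exact Submodule.subset_span ⟨j, rfl⟩
        have h3 : Set.range ((fun j => W.mkQ (a j)) ∘ f) = W.mkQ '' (Set.range (a ∘ f)) := by
          rw [← Set.range_comp]; rfl
        rw [h3, Submodule.span_image] at h2
        obtain ⟨y, hy, hy2⟩ := h2
        have h4 : a j - y ∈ W := by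
          rw [← Submodule.ker_mkQ W, LinearMap.mem_ker, map_sub, hy2, sub_self]
        have h5 : y ∈ Submodule.span ℚ (Set.range (fun o : Option (Fin k) ⊕ κ =>
          Sum.elim (fun o : Option (Fin k) => o.elim (1 : ℝ) b) (a ∘ f) o)) := by
          refine Submodule.span_mono ?_ hy
          rintro _ ⟨o, rfl⟩
          exact ⟨Sum.inr o, rfl⟩
        have := Submodule.add_mem _ (hWle h4) h5
        simpa using this
    have h2 := linearIndependent_le_span' _ ha _ h1
    have h3 : Fintype.card (Set.range (fun o : Option (Fin k) ⊕ κ =>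
          Sum.elim (fun o : Option (Fin k) => o.elim (1 : ℝ) b) (a ∘ f) o)) ≤
          Fintype.card (Option (Fin k) ⊕ κ) := Fintype.card_range_le _
    simp at h2 h3
    have h4 : Fintype.card ι + 1 ≤ Fintype.card (Set.range (fun o : Option (Fin k) ⊕ κ =>
          Sum.elim (fun o : Option (Fin k) => o.elim (1 : ℝ) b) (a ∘ f) o)) := by
      simp
      exact_mod_cast h2
    simp at h4
    omega
  have hk := kronecker (K := Fin k ⊕ κ) (Sum.elim β (fun j => (a (f j) : AddCircle (1 : ℝ))))
    (Sum.elim (fun _ => 0) (fun j => w (f j))) (by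
      intro p hp
      simp only [Fintype.sum_sum_type, Sum.elim_inl, Sum.elim_inr] at hp ⊢
      have hq : ∀ j, p (Sum.inr j) = 0 := by
        have h1 : ((∑ i, p (Sum.inl i) • b i + ∑ j, p (Sum.inr j) • a (f j) : ℝ) : AddCircle (1 : ℝ)) = 0 := by
          rw [← hp]
          simp only [AddCircle.coe_add, ← hb]
          congr 1
          · exact map_sum (QuotientAddGroup.mk' _) _ _
          · exact map_sum (QuotientAddGroup.mk' _) _ _
        rw [AddCircle.coe_eq_zero_iff] at h1
        obtain ⟨z, hz⟩ := h1
        have h2 : ∑ j, (p (Sum.inr j) : ℚ) • (W.mkQ (a (f j))) = 0 := by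
          have h3 : ∑ j, (p (Sum.inr j) : ℚ) • (a (f j)) ∈ W := by
            have h4 : ∑ j, (p (Sum.inr j) : ℚ) • (a (f j)) =
              (z : ℚ) • (1 : ℝ) - ∑ i, (p (Sum.inl i) : ℚ) • b i := by
              simp only [Int.cast_smul_eq_zsmul]
              rw [hz]; abel
            rw [h4]
            exact W.sub_mem (W.smul_mem _ (hW none))
              (W.sum_mem fun i _ => W.smul_mem _ (hW (some i)))
          rw [← Submodule.ker_mkQ W, LinearMap.mem_ker, map_sum] at h3
          simpa using h3
        have h3 := Fintype.linearIndependent_iff.1 hli _ h2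
        intro j
        exact_mod_cast h3 j
      simp [hq])
  rw [← SetLike.mem_coe, AddSubgroup.topologicalClosure_coe, Metric.mem_closure_iff] at hk
  obtain ⟨y, ⟨n, rfl⟩, hn⟩ := hk ε hε
  rw [dist_comm, dist_pi_lt_iff hε] at hn
  refine ⟨n, fun i => ?_, ?_⟩
  · simpa using hn (Sum.inl i)
  · have h1 : {j | ¬ ‖n • (a j : AddCircle (1 : ℝ)) - w j‖ < ε} ⊆ ((Finset.univ.image f)ᶜ : Finset ι) := by
      intro j hj
      simp only [Finset.coe_compl, Set.mem_compl_iff, Finset.mem_coe, Finset.mem_image,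
        Finset.mem_univ, true_and]
      rintro ⟨i, rfl⟩
      apply hj
      have := hn (Sum.inr i)
      rw [dist_eq_norm] at this
      exact this
    refine (Set.ncard_le_ncard h1 (Finset.finite_toSet _)).trans ?_
    rw [Set.ncard_coe_finset, Finset.card_compl, Finset.card_image_of_injective _ hf]
    simp only [Finset.card_univ]
    omega

lemma exists_indep (ι : Type) [Finite ι] :
    ∃ t : ι → ℝ, LinearIndependent ℚ (fun o : Option ι => o.elim (1 : ℝ) t) := by
  obtain ⟨x, hx⟩ : ∃ x : ℝ, Transcendental ℚ x := by
    by_contra! h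
    have h1 : Algebra.IsAlgebraic ℚ ℝ := ⟨fun x => by have := h x; unfold Transcendental at this; exact not_not.1 this⟩
    have h2 := Algebra.IsAlgebraic.cardinalMk_le_max ℚ ℝ
    simp at h2
    exact absurd h2 (not_le.2 (by rw [Cardinal.mk_real]; exact Cardinal.aleph0_lt_continuum))
  have h1 : LinearIndependent ℚ (fun n : ℕ => x ^ n) := by
    have h2 := (Polynomial.basisMonomials ℚ).linearIndependent.map'
      (Polynomial.aeval x).toLinearMap
      (LinearMap.ker_eq_bot.2 (transcendental_iff_injective.1 hx))
    have h3 : (fun n : ℕ => x ^ n) = ⇑(Polynomial.aeval x).toLinearMap ∘ ⇑(Polynomial.basisMonomials ℚ) := by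
      funext n
      simp
    rw [h3]
    exact h2
  have := Fintype.ofFinite ι
  let e := Fintype.equivFin ι
  let g : Option ι → ℕ := fun o => o.elim 0 (fun i => (e i : ℕ) + 1)
  have hg : Function.Injective g := by
    rintro (_ | i) (_ | j) h
    · rfl
    · simp [g] at h
    · simp [g] at h
    · simp [g] at h
      simpa [Fin.val_inj] using h
  refine ⟨fun i => x ^ ((e i : ℕ) + 1), ?_⟩
  convert h1.comp g hg using 1
  funext o
  cases o <;> simp [g]

lemma exists_indep_near (ι : Type) [Finite ι] (q : ι → ℚ) (η : ℝ) (hη : 0 < η) :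
    ∃ a : ι → ℝ, LinearIndependent ℚ (fun o : Option ι => o.elim (1 : ℝ) a) ∧
      ∀ j, |a j - q j| < η := by
  have := Fintype.ofFinite ι
  obtain ⟨t, ht⟩ := exists_indep ι
  obtain ⟨Q, hQ⟩ := exists_nat_gt ((∑ j, |t j|) / η)
  have hQ0 : (0 : ℝ) < Q := lt_of_le_of_lt (by positivity) hQ
  refine ⟨fun j => q j + t j / Q, ?_, ?_⟩
  · rw [Fintype.linearIndependent_iff] at ht ⊢
    intro g hg
    rw [Fintype.sum_option] at hg
    simp only [Option.elim, Rat.smul_def] at hg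
    let g' : Option ι → ℚ := fun o => o.elim (g none + ∑ j, g (some j) * q j) (fun j => g (some j) / Q)
    have h1 := ht g' (by
      rw [Fintype.sum_option]
      simp only [Option.elim, Rat.smul_def, g']
      rw [← hg]
      push_cast
      simp only [mul_add, Finset.sum_add_distrib]
      rw [mul_one, mul_one, add_assoc]
      congr 2
      apply Finset.sum_congr rfl
      intro j _
      ring)
    have h2 : ∀ j, g (some j) = 0 := by
      intro j
      have := h1 (some j)
      have hQ1 : (Q : ℚ) ≠ 0 := by
        have : (Q : ℝ) ≠ 0 := hQ0.ne'
        exact_mod_cast this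
      simpa [g', hQ1] using this
    rintro (_ | j)
    · have := h1 none
      simpa [g', h2] using this
    · exact h2 j
  · intro j
    rw [div_lt_iff₀ hη] at hQ
    have h1 : |t j| ≤ ∑ j, |t j| := Finset.single_le_sum (f := fun j => |t j|) (fun i _ => abs_nonneg _) (Finset.mem_univ j)
    simp only [add_sub_cancel_left]
    rw [abs_div, abs_of_pos hQ0, div_lt_iff₀ hQ0]
    linarith

lemma coe_norm_le (x : ℝ) : ‖(x : AddCircle (1 : ℝ))‖ ≤ |x| := by
  exact QuotientAddGroup.norm_mk_le_norm

lemma main_step {δ : ℝ} (hδ : 0 ≤ δ) (M : Finset ℤ) (E : ℤ → Set ℤ)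
    (hE : ∀ m, (E m).Finite ∧ (E m).Nonempty ∧ NR δ (E m)) {S : Set ℤ} (hS : BohrDense S) (k : ℕ) :
    ∃ F : Set ℤ, F.Finite ∧ F ⊆ S ∧
      (∀ x : ℤ, |x| ≤ k → ∀ β : Fin k → AddCircle (1 : ℝ), ∃ n ∈ F, ∀ i, ‖(n - x) • β i‖ < 1 / ((k : ℝ) + 1)) ∧
      ∀ m ∈ M, NR δ (E m ∪ (fun s => s - m) '' F) := by
  classical
  choose N c B hN hcard hc hEB using fun m => NR.add_point hδ (hE m).1 (hE m).2.1 (hE m).2.2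
  choose d τ hτ hsys using fun m => system (hN m) (B m) δ (hcard m) k
  let ι := Σ m : M, Fin (d m.1)
  obtain ⟨τ₀, hτ₀, hτ₀'⟩ : ∃ τ₀ > 0, ∀ m ∈ M, τ₀ ≤ τ m := by
    obtain rfl | hne := M.eq_empty_or_nonempty
    · exact ⟨1, one_pos, by simp⟩
    · obtain ⟨i, hi, hi'⟩ := Finset.exists_min_image M τ hne
      exact ⟨τ i, hτ i, hi'⟩
  obtain ⟨R, hR⟩ : ∃ R : ℝ, ∀ m ∈ M, ∀ e ∈ E m, |(e : ℝ)| < R := by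
    have hfin : (⋃ m ∈ M, E m).Finite := M.finite_toSet.biUnion fun m _ => (hE m).1
    obtain ⟨R, hR⟩ := (hfin.image (fun e : ℤ => |(e : ℝ)|)).bddAbove
    refine ⟨R + 1, fun m hm e he => lt_of_le_of_lt (hR ⟨e, ?_, rfl⟩) (lt_add_one _)⟩
    simp only [Set.mem_iUnion]
    exact ⟨m, hm, he⟩
  obtain ⟨a, haLI, ha⟩ := exists_indep_near ι (fun j => 1 / (N j.1 : ℚ)) (τ₀ / (|R| + 1)) (by positivity)
  let α : ι → AddCircle (1 : ℝ) := fun j => (a j : AddCircle (1 : ℝ))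
  let w : ι → AddCircle (1 : ℝ) := fun j => ((c j.1 / N j.1 : ℝ) : AddCircle (1 : ℝ)) + (j.1 : ℤ) • α j
  let F0 : Set ℤ := {n | n ∈ S ∧ Set.ncard {j : ι | ¬ ‖n • α j - w j‖ < τ₀} ≤ k}
  have hcover : ∀ x : ℤ, ∀ β : Fin k → AddCircle (1 : ℝ), ∃ n ∈ F0, ∀ i, ‖(n - x) • β i‖ < 1 / ((k : ℝ) + 1) := by
    intro x β
    obtain ⟨ε, hε, hε1, hε2⟩ : ∃ ε > 0, ε + ε ≤ τ₀ ∧ ε + ε ≤ 1 / ((k : ℝ) + 1) := by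
      refine ⟨min (τ₀ / 2) (1 / ((k : ℝ) + 1) / 2), by positivity, ?_, ?_⟩
      · linarith [min_le_left (τ₀ / 2) (1 / ((k : ℝ) + 1) / 2)]
      · linarith [min_le_right (τ₀ / 2) (1 / ((k : ℝ) + 1) / 2)]
    obtain ⟨n', h1, h2⟩ := hamming a haLI k β (fun j => w j - x • α j) ε hε
    obtain ⟨s, hs, hs'⟩ := bohr_exists hS (Sum.elim β α) (n' + x) (fun _ => ε) (fun _ => hε)
    refine ⟨s, ⟨hs, ?_⟩, ?_⟩
    · refine (Set.ncard_le_ncard ?_ (Set.toFinite _)).trans h2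
      intro j hj hj2
      apply hj
      have h3 : s • α j - w j = (s - (n' + x)) • α j + (n' • α j - (w j - x • α j)) := by
        simp only [sub_smul, add_smul]; abel
      rw [h3]
      refine (norm_add_le _ _).trans_lt (lt_of_lt_of_le ?_ hε1)
      exact add_lt_add (hs' (Sum.inr j)) hj2
    · intro i
      have h3 : (s - x) • β i = (s - (n' + x)) • β i + n' • β i := by
        simp only [sub_smul, add_smul]; abel
      rw [h3]
      refine (norm_add_le _ _).trans_lt (lt_of_lt_of_le ?_ hε2)
      exact add_lt_add (hs' (Sum.inl i)) (h1 i)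
  have hfin : ∀ x : ℤ, ∃ F : Set ℤ, F.Finite ∧ F ⊆ F0 ∧
      ∀ β : Fin k → AddCircle (1 : ℝ), ∃ n ∈ F, ∀ i, ‖(n - x) • β i‖ < 1 / ((k : ℝ) + 1) := by
    intro x
    obtain ⟨t, ht⟩ := (isCompact_univ (X := Fin k → AddCircle (1 : ℝ))).elim_finite_subcover
      (fun n : F0 => {β | ∀ i, ‖((n : ℤ) - x) • β i‖ < 1 / ((k : ℝ) + 1)}) (by
        intro n
        rw [Set.ofPred_forall]
        refine isOpen_iInter_of_finite fun i => isOpen_lt ?_ continuous_const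
        fun_prop) (by
        intro β _
        obtain ⟨n, hn, h⟩ := hcover x β
        exact Set.mem_iUnion.2 ⟨⟨n, hn⟩, h⟩)
    refine ⟨Subtype.val '' (t : Set F0), t.finite_toSet.image _, ?_, ?_⟩
    · rintro _ ⟨n, _, rfl⟩; exact n.2
    · intro β
      have := ht (Set.mem_univ β)
      simp only [Set.mem_iUnion] at this
      obtain ⟨n, hn, h⟩ := this
      exact ⟨n, ⟨n, hn, rfl⟩, h⟩
  choose G hG1 hG2 hG3 using hfin
  refine ⟨⋃ x ∈ Set.Icc (-(k : ℤ)) k, G x, (Set.finite_Icc _ _).biUnion fun x _ => hG1 x, ?_, ?_, ?_⟩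
  · intro n hn
    simp only [Set.mem_iUnion] at hn
    obtain ⟨x, _, hn⟩ := hn
    exact (hG2 x hn).1
  · intro x hx β
    obtain ⟨n, hn, h⟩ := hG3 x β
    refine ⟨n, ?_, h⟩
    simp only [Set.mem_iUnion]
    exact ⟨x, abs_le.1 hx, hn⟩
  · intro m hm
    refine (hsys m (fun j => α ⟨⟨m, hm⟩, j⟩)).mono ?_
    rintro n (hn | ⟨s, hs, rfl⟩)
    · refine ⟨n, hEB m n hn, ?_⟩
      have : {j : Fin (d m) | ¬ ‖n • α ⟨⟨m, hm⟩, j⟩ - ((n / N m : ℝ) : AddCircle (1 : ℝ))‖ < τ m} = ∅ := by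
        ext j
        simp only [Set.mem_ofPred_eq, Set.mem_empty_iff_false, iff_false, not_not]
        have h1 : n • α ⟨⟨m, hm⟩, j⟩ - ((n / N m : ℝ) : AddCircle (1 : ℝ)) =
          ((n * (a ⟨⟨m, hm⟩, j⟩ - 1 / N m) : ℝ) : AddCircle (1 : ℝ)) := by
          simp only [α]
          rw [← AddCircle.coe_zsmul, ← AddCircle.coe_sub]
          congr 1
          simp only [zsmul_eq_mul]
          ring
        rw [h1]
        refine (coe_norm_le _).trans_lt (lt_of_lt_of_le ?_ (hτ₀' m hm))
        have h2 := ha ⟨⟨m, hm⟩, j⟩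
        push_cast at h2
        have h3 := hR m hm n hn
        rw [lt_div_iff₀ (by positivity)] at h2
        rw [abs_mul]
        nlinarith [abs_nonneg (n : ℝ), abs_nonneg (a ⟨⟨m, hm⟩, j⟩ - 1 / N m), le_abs_self R]
      rw [this]; simp
    · simp only [Set.mem_iUnion] at hs
      obtain ⟨x, _, hs⟩ := hs
      have hs0 := (hG2 x hs).2
      refine ⟨c m, hc m, ?_⟩
      refine le_trans ?_ hs0
      refine Set.ncard_le_ncard_of_injOn (fun j : Fin (d m) => (⟨⟨m, hm⟩, j⟩ : ι)) ?_ ?_ (Set.toFinite _)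
      · intro j hj hj2
        apply hj
        have h1 : (s - m) • α ⟨⟨m, hm⟩, j⟩ - ((c m / N m : ℝ) : AddCircle (1 : ℝ)) =
          s • α ⟨⟨m, hm⟩, j⟩ - w ⟨⟨m, hm⟩, j⟩ := by
          simp only [w, sub_smul]; abel
        rw [h1]
        exact lt_of_lt_of_le hj2 (hτ₀' m hm)
      · intro i _ j _ hij
        exact eq_of_heq (Sigma.mk.inj hij).2

lemma zpow_succ_apply' {X : Type} (T : Equiv.Perm X) (n : ℤ) (x : X) :
    (T ^ n) (T x) = (T ^ (n + 1)) x := by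
  rw [zpow_add_one, Equiv.Perm.mul_apply]

lemma measurable_zpow {X : Type} [MeasurableSpace X] (T : X ≃ᵐ X) (n : ℤ) :
    Measurable (T.toEquiv ^ n : Equiv.Perm X) := by
  induction n using Int.induction_on with
  | zero => exact measurable_id
  | succ k ih =>
    rw [zpow_add_one]
    exact ih.comp T.measurable
  | pred k ih =>
    rw [zpow_sub_one]
    exact ih.comp T.symm.measurable

/-- The shift on two-sided binary sequences. -/
def shiftE : (ℤ → Bool) ≃ᵐ (ℤ → Bool) where
  toFun x n := x (n + 1)
  invFun x n := x (n - 1)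
  left_inv x := by funext n; simp
  right_inv x := by funext n; simp
  measurable_toFun := by
    show Measurable (fun (x : ℤ → Bool) (n : ℤ) => x (n + 1))
    fun_prop
  measurable_invFun := by
    show Measurable (fun (x : ℤ → Bool) (n : ℤ) => x (n - 1))
    fun_prop

lemma shiftE_zpow (n : ℤ) (x : ℤ → Bool) (i : ℤ) : (shiftE.toEquiv ^ n) x i = x (i + n) := by
  induction n using Int.induction_on generalizing x with
  | zero => simp
  | succ k ih =>
    rw [zpow_add_one, Equiv.Perm.mul_apply, ih]
    change x (i + k + 1) = _
    rw [add_assoc]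
  | pred k ih =>
    rw [zpow_sub_one, Equiv.Perm.mul_apply, ih]
    change x (i + -k - 1) = _
    congr 1; ring

lemma continuous_shiftE : Continuous shiftE := by
  show Continuous (fun (x : ℤ → Bool) (n : ℤ) => x (n + 1))
  fun_prop

/-- Cylinder. -/
def cyl (n : ℤ) : Set (ℤ → Bool) := {x | x 0 = true ∧ x n = true}

lemma isClopen_cyl (n : ℤ) : IsClopen (cyl n) := by
  have h : ∀ i : ℤ, IsClopen {x : ℤ → Bool | x i = true} := fun i =>
    (isClopen_discrete {true}).preimage (continuous_apply i)
  exact (h 0).inter (h n)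

lemma continuous_clopen {Y : Set (ℤ → Bool)} (hY : IsClopen Y) :
    Continuous (fun P : ProbabilityMeasure (ℤ → Bool) => P Y) := by
  rw [continuous_iff_continuousAt]
  intro P
  apply ProbabilityMeasure.tendsto_measure_of_null_frontier_of_tendsto (L := nhds P) (μs := id) tendsto_id
  rw [hY.frontier_eq]
  simp

lemma compactness {δ : ℝ} (hδ : 0 < δ) (E : ℕ → Set ℤ) (hmono : ∀ k, E k ⊆ E (k + 1))
    (h : ∀ k, NR δ (E k)) : NR 0 (⋃ k, E k) := by
  classical
  let C : ℕ → Set (ProbabilityMeasure (ℤ → Bool)) := fun k =>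
    {P | P.map shiftE.measurable.aemeasurable = P} ∩ {P | δ ≤ P (cyl 0)} ∩
      ⋂ n ∈ E k, {P | P (cyl n) = 0}
  have hclosed : ∀ k, IsClosed (C k) := by
    intro k
    refine ((isClosed_eq (ProbabilityMeasure.continuous_map continuous_shiftE) continuous_id).inter
      (isClosed_le continuous_const ?_)).inter (isClosed_biInter fun n _ => isClosed_eq ?_ continuous_const)
    · exact NNReal.continuous_coe.comp (continuous_clopen (isClopen_cyl 0))
    · exact continuous_clopen (isClopen_cyl n)
  have hne : ∀ k, (C k).Nonempty := by
    intro k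
    obtain ⟨X, _, μ, T, D, h1, h2, h3, h4, h5⟩ := h k
    let φ : X → (ℤ → Bool) := fun x n => decide ((T.toEquiv ^ n) x ∈ D)
    have hφ : Measurable φ := by
      refine measurable_pi_lambda _ fun n => ?_
      refine measurable_to_bool ?_
      have : (fun x => φ x n) ⁻¹' {true} = (T.toEquiv ^ n : Equiv.Perm X) ⁻¹' D := by
        ext x; simp [φ]
      rw [this]
      exact measurable_zpow T n h3
    let P : ProbabilityMeasure (ℤ → Bool) := ⟨μ.map φ, Measure.isProbabilityMeasure_map hφ.aemeasurable⟩
    have hP : ∀ n, (P : Measure (ℤ → Bool)) (cyl n) = μ {x | x ∈ D ∧ (T.toEquiv ^ n) x ∈ D} := by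
      intro n
      change μ.map φ _ = _
      rw [Measure.map_apply hφ (isClopen_cyl n).1.measurableSet]
      congr 1
      ext x
      simp [cyl, φ]
    refine ⟨P, ⟨⟨?_, ?_⟩, ?_⟩⟩
    · apply Subtype.ext
      change (μ.map φ).map shiftE = μ.map φ
      rw [Measure.map_map shiftE.measurable hφ]
      have : shiftE ∘ φ = φ ∘ T := by
        funext x n
        change decide _ = decide _
        congr 2
        exact (zpow_succ_apply' T.toEquiv n x).symm
      rw [this, ← Measure.map_map hφ T.measurable, h2.map_eq]
    · have := hP 0
      simp only [zpow_zero, Equiv.Perm.coe_one, id, and_self] at this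
      change δ ≤ ((P : Measure (ℤ → Bool)) (cyl 0)).toReal
      rw [this]
      exact h4.le
    · simp only [Set.mem_iInter]
      intro n hn
      have h6 := hP n
      have : {x | x ∈ D ∧ (T.toEquiv ^ n) x ∈ D} = ∅ := by
        ext x
        simp only [Set.mem_ofPred_eq, Set.mem_empty_iff_false, iff_false]
        rintro ⟨h7, h8⟩
        exact h5 n hn x h7 h8
      rw [this, measure_empty] at h6
      exact (ProbabilityMeasure.null_iff_toMeasure_null P _).2 h6
  obtain ⟨P, hP⟩ := IsCompact.nonempty_iInter_of_sequence_nonempty_isCompact_isClosed C (by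
    rintro k P ⟨hP1, hP2⟩
    refine ⟨hP1, ?_⟩
    simp only [Set.mem_iInter] at hP2 ⊢
    exact fun n hn => hP2 n (hmono k hn)) hne (hclosed 0).isCompact hclosed
  rw [Set.mem_iInter] at hP
  refine ⟨ℤ → Bool, inferInstance, P, shiftE, cyl 0 \ ⋃ n ∈ ⋃ k, E k, cyl n, inferInstance,
    ⟨shiftE.measurable, congrArg Subtype.val (hP 0).1.1⟩, ?_, ?_, ?_⟩
  · exact (isClopen_cyl 0).1.measurableSet.diff
      (MeasurableSet.biUnion (Set.to_countable _) fun n _ => (isClopen_cyl n).1.measurableSet)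
  · have h0 : (P : Measure (ℤ → Bool)) (⋃ n ∈ ⋃ k, E k, cyl n) = 0 := by
      rw [measure_biUnion_null_iff (Set.to_countable _)]
      intro n hn
      obtain ⟨k, hk⟩ := Set.mem_iUnion.1 hn
      have := (hP k).2
      simp only [Set.mem_iInter] at this
      exact (ProbabilityMeasure.null_iff_toMeasure_null P _).1 (this n hk)
    rw [measureReal_def, measure_sdiff_null h0]
    exact hδ.trans_le (hP 0).1.2
  · rintro n hn x hx hx2
    apply hx.2
    simp only [Set.mem_iUnion]
    refine ⟨n, Set.mem_iUnion.1 hn, hx.1.1, ?_⟩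
    have := hx2.1.1
    rwa [shiftE_zpow, zero_add] at this

lemma prod_zpow {X Y : Type} [MeasurableSpace X] [MeasurableSpace Y] (T : X ≃ᵐ X) (R : Y ≃ᵐ Y)
    (n : ℤ) (x : X) (y : Y) : ((MeasurableEquiv.prodCongr T R).toEquiv ^ n) (x, y) =
      ((T.toEquiv ^ n) x, (R.toEquiv ^ n) y) := by
  induction n using Int.induction_on generalizing x y with
  | zero => simp
  | succ k ih =>
    rw [zpow_add_one, Equiv.Perm.mul_apply, zpow_add_one, Equiv.Perm.mul_apply, zpow_add_one, Equiv.Perm.mul_apply]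
    exact ih _ _
  | pred k ih =>
    rw [zpow_sub_one, Equiv.Perm.mul_apply, zpow_sub_one, Equiv.Perm.mul_apply, zpow_sub_one, Equiv.Perm.mul_apply]
    exact ih _ _

lemma NR.union_finite {E F : Set ℤ} (h : NR 0 E) (hF : F.Finite) (h0 : (0 : ℤ) ∉ F) : NR 0 (E ∪ F) := by
  obtain ⟨X, _, μ, T, D, h1, h2, h3, h4, h5⟩ := h
  let α : AddCircle (1 : ℝ) := ((√2 : ℝ) : AddCircle (1 : ℝ))
  have hα : ∀ n : ℤ, n ≠ 0 → n • α ≠ 0 := by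
    intro n hn h
    have h6 : ((n * √2 : ℝ) : AddCircle (1 : ℝ)) = 0 := by
      rw [← h]
      simp only [α]
      rw [← AddCircle.coe_zsmul, zsmul_eq_mul]
    rw [AddCircle.coe_eq_zero_iff] at h6
    obtain ⟨z, hz⟩ := h6
    have := irrational_sqrt_two.intCast_mul hn
    apply this
    refine ⟨z, ?_⟩
    rw [← hz]; simp
  obtain ⟨r, hr, hr'⟩ : ∃ r > 0, ∀ n ∈ F, r + r ≤ ‖n • α‖ := by
    obtain rfl | hne := F.eq_empty_or_nonempty
    · exact ⟨1, one_pos, by simp⟩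
    · obtain ⟨i, hi, hi'⟩ := Set.exists_min_image F (fun n => ‖n • α‖) hF hne
      refine ⟨‖i • α‖ / 2, ?_, fun n hn => by rw [add_halves]; exact hi' n hn⟩
      have := norm_pos_iff.2 (hα i (by rintro rfl; exact h0 hi))
      positivity
  have hprob : IsProbabilityMeasure (volume : Measure (AddCircle (1 : ℝ))) :=
    ⟨by simp [AddCircle.measure_univ]⟩
  refine ⟨X × AddCircle (1 : ℝ), inferInstance, μ.prod volume,
    MeasurableEquiv.prodCongr T (MeasurableEquiv.addRight α), D ×ˢ Metric.ball 0 r, inferInstance,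
    h2.prod (measurePreserving_add_right volume α), h3.prod measurableSet_ball, ?_, ?_⟩
  · rw [measureReal_prod_prod]
    refine mul_pos h4 ?_
    rw [measureReal_def]
    exact ENNReal.toReal_pos (Metric.measure_ball_pos _ _ hr).ne' (measure_ne_top _ _)
  · rintro n hn ⟨x, y⟩ ⟨hx, hy⟩ hxy
    rw [prod_zpow, addRight_zpow] at hxy
    obtain ⟨hx', hy'⟩ := hxy
    rcases hn with hn | hn
    · exact h5 n hn x hx hx'
    · simp only [Metric.mem_ball, dist_zero_right] at hy hy'
      have : n • α = (y + n • α) - y := by abel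
      have h6 := hr' n hn
      rw [this] at h6
      linarith [norm_sub_le (y + n • α) y]

lemma NR_one : NR (1 / 3) {1} := by
  obtain ⟨d, τ, hτ, h⟩ := system (N := 4) le_rfl {0, 2} (1 / 3) (by
    rw [Finset.card_pair (by decide)]; norm_num) 0
  refine (h (fun _ => ((1 / 4 : ℝ) : AddCircle (1 : ℝ)))).mono ?_
  rintro _ rfl
  refine ⟨1, by decide, ?_⟩
  simp [hτ]

/-- State of the recursion. -/
def St : Type := {E : ℤ → Set ℤ // ∀ m, (E m).Finite ∧ (E m).Nonempty ∧ NR (1 / 3) (E m)}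

lemma step_exists {S : Set ℤ} (hS : BohrDense S) (k : ℕ) (E : St) :
    ∃ (F : Set ℤ) (E' : St), F.Finite ∧ F ⊆ S ∧
      (∀ x : ℤ, |x| ≤ k → ∀ β : Fin k → AddCircle (1 : ℝ), ∃ n ∈ F, ∀ i, ‖(n - x) • β i‖ < 1 / ((k : ℝ) + 1)) ∧
      (∀ m, E.1 m ⊆ E'.1 m) ∧ ∀ m : ℤ, |m| ≤ k → (fun s => s - m) '' F ⊆ E'.1 m := by
  obtain ⟨F, h1, h2, h3, h4⟩ := main_step (δ := 1 / 3) (by norm_num) (Finset.Icc (-(k : ℤ)) k) E.1 E.2 hS k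
  classical
  refine ⟨F, ⟨fun m => if |m| ≤ k then E.1 m ∪ (fun s => s - m) '' F else E.1 m, ?_⟩, h1, h2, h3, ?_, ?_⟩
  · intro m
    dsimp only
    split_ifs with hm
    · refine ⟨(E.2 m).1.union (h1.image _), (E.2 m).2.1.mono Set.subset_union_left, h4 m ?_⟩
      rw [Finset.mem_Icc]
      exact abs_le.1 hm
    · exact E.2 m
  · intro m
    dsimp only
    split_ifs with hm
    · exact Set.subset_union_left
    · exact subset_rfl
  · intro m hm
    dsimp only
    rw [if_pos hm]
    exact Set.subset_union_right

lemma stmt_aux (S : Set ℤ) (hS : BohrDense S) :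
    ∃ S' : Set ℤ, S' ⊆ S ∧ BohrDense S' ∧ ∀ m : ℤ, NR 0 ({x | x + m ∈ S'} \ {0}) := by
  choose F nxt hF1 hF2 hF3 hF4 hF5 using step_exists hS
  let E0 : St := ⟨fun _ => {1}, fun _ => ⟨Set.finite_singleton _, Set.singleton_nonempty _, NR_one⟩⟩
  let st : ℕ → St := fun k => Nat.rec E0 (fun k E => nxt k E) k
  have hst : ∀ k, st (k + 1) = nxt k (st k) := fun k => rfl
  refine ⟨⋃ k, F k (st k), Set.iUnion_subset fun k => hF2 k _, ?_, ?_⟩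
  · apply bohr_of
    intro x l β ε hε
    obtain ⟨q, hq⟩ := exists_nat_one_div_lt hε
    let k := max q (max l x.natAbs)
    have hkq : q ≤ k := le_max_left _ _
    have hkl : l ≤ k := (le_max_left _ _).trans (le_max_right _ _)
    have hkx : x.natAbs ≤ k := (le_max_right _ _).trans (le_max_right _ _)
    obtain ⟨n, hn, hn2⟩ := hF3 k (st k) x (by rw [Int.abs_eq_natAbs]; exact_mod_cast hkx)
      (fun i => if h : (i : ℕ) < l then β ⟨i, h⟩ else 0)
    refine ⟨n, Set.mem_iUnion.2 ⟨k, hn⟩, fun i => ?_⟩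
    have := hn2 ⟨i, i.2.trans_le hkl⟩
    simp only [i.2, dif_pos] at this
    refine (this.trans_le ?_).trans hq
    apply one_div_le_one_div_of_le (by positivity)
    have : (q : ℝ) ≤ k := by exact_mod_cast hkq
    linarith
  · intro m
    have h1 : NR 0 (⋃ k, (st k).1 m) := compactness (δ := 1 / 3) (by norm_num) _
      (fun k => by rw [hst]; exact hF4 k _ m) (fun k => ((st k).2 m).2.2)
    have h2 := h1.union_finite (F := ((fun s => s - m) '' ⋃ k ∈ Finset.range m.natAbs, F k (st k)) \ {0})
      (((Finset.finite_toSet _).biUnion fun k _ => hF1 k _).image _ |>.subset Set.sdiff_subset) (by simp)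
    refine h2.mono ?_
    rintro x ⟨hx, hx0⟩
    obtain ⟨k, hk⟩ := Set.mem_iUnion.1 hx
    by_cases hkm : k < m.natAbs
    · right
      refine ⟨⟨x + m, ?_, by simp⟩, hx0⟩
      simp only [Set.mem_iUnion]
      exact ⟨k, Finset.mem_range.2 hkm, hk⟩
    · left
      refine Set.mem_iUnion.2 ⟨k + 1, ?_⟩
      rw [hst]
      refine hF5 k _ m ?_ ⟨x + m, hk, by simp⟩
      rw [Int.abs_eq_natAbs]
      exact_mod_cast not_lt.1 hkm

lemma NR.not_rec {E : Set ℤ} (h : NR 0 E) : ¬ IsSetOfMeasurableRecurrence E := by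
  obtain ⟨X, _, μ, T, D, h1, h2, h3, h4, h5⟩ := h
  intro hr
  obtain ⟨n, hn, y, hy, x, hx, rfl⟩ := hr X _ μ h1 T h2 D h3 (by
    rw [measureReal_def] at h4
    exact (ENNReal.toReal_pos_iff.1 h4).1)
  exact h5 n hn x hx hy

theorem stmt2 (S : Set ℤ) (hS : BohrDense S) :
    ∃ S' : Set ℤ, S' ⊆ S ∧ BohrDense S' ∧
      ∀ m : ℤ, ¬ IsSetOfMeasurableRecurrence (((fun s => s - m) '' S') \ {0}) := by
  obtain ⟨S', h1, h2, h3⟩ := stmt_aux S hS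
  refine ⟨S', h1, h2, fun m => ((h3 m).mono ?_).not_rec⟩
  rintro _ ⟨⟨s, hs, rfl⟩, h0⟩
  refine ⟨?_, h0⟩
  simpa using hs
end

section
/- Let S ⊆ ℤ and δ ≥ 0. The following are equivalent: (i) there is a set A ⊆ ℤ with upper Banach density d*(A) > δ such that (A − A) ∩ S = ∅; (ii) there is a measure preserving system (X, μ, T) and a measurable set D ⊆ X with μ(D) > δ such that D ∩ TⁿD = ∅ for all n ∈ S. -/
open MeasureTheory Filter Pointwise

/-- Upper Banach density of a set of integers:
`d*(A) = limsup_{n→∞} sup_{k∈ℤ} |A ∩ {k+1,…,k+n}| / n`. -/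
noncomputable def upperBanachDensity (A : Set ℤ) : ℝ :=
  Filter.atTop.limsup fun n : ℕ =>
    ⨆ k : ℤ, (Nat.card ↥(A ∩ Set.Ioc k (k + n)) : ℝ) / n

theorem avg_aux {X : Type} [TopologicalSpace X] [CompactSpace X] [T2Space X] [MeasurableSpace X]
    [BorelSpace X] [HasOuterApproxClosed X] (T : X → X) (hT : Continuous T) (D : Set X)
    (hD : IsClopen D) (c : ℝ)
    (h : ∀ N : ℕ, ∃ n ≥ N, ∃ y : X, c * n ≤ (Nat.card {i : ℕ // i < n ∧ T^[i] y ∈ D} : ℝ)) :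
    ∃ μ : Measure X, IsProbabilityMeasure μ ∧ MeasurePreserving T μ μ ∧ ENNReal.ofReal c ≤ μ D := by
  classical
  choose n hn y hy using fun N => h (N + 1)
  have hpos : ∀ N, (0:ℝ) < n N := fun N => by have := hn N; exact_mod_cast (by omega)
  have hne : ∀ N, (n N : ENNReal) ≠ 0 := fun N => by have := hn N; exact_mod_cast (by omega)
  let ν : ℕ → Measure X := fun N =>
    (n N : ENNReal)⁻¹ • ∑ i ∈ Finset.range (n N), Measure.dirac (T^[i] (y N))
  have hν : ∀ N, IsProbabilityMeasure (ν N) := fun N => ⟨by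
    simp [ν, ENNReal.inv_mul_cancel (hne N)]⟩
  have hint : ∀ N (f : BoundedContinuousFunction X ℝ),
      ∫ x, f x ∂(ν N) = (n N : ℝ)⁻¹ * ∑ i ∈ Finset.range (n N), f (T^[i] (y N)) := by
    intro N f
    simp only [ν]
    rw [integral_smul_measure, integral_finsetSum_measure]
    · simp
    · intro i _
      exact f.integrable _
  have hDν : ∀ N, ENNReal.ofReal c ≤ ν N D := by
    intro N
    have e : ν N D = (n N : ENNReal)⁻¹ * (Nat.card {i : ℕ // i < n N ∧ T^[i] (y N) ∈ D} : ENNReal) := by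
      simp only [ν, Measure.smul_apply, Measure.finsetSum_apply, smul_eq_mul]
      congr 1
      have : Nat.card {i : ℕ // i < n N ∧ T^[i] (y N) ∈ D} =
          ((Finset.range (n N)).filter (fun i => T^[i] (y N) ∈ D)).card := by
        rw [← Nat.card_eq_finsetCard]; simp
      rw [this, Finset.card_filter]
      push_cast
      refine Finset.sum_congr rfl fun i _ => ?_
      rw [Measure.dirac_apply' _ hD.1.measurableSet]
      simp [Set.indicator]
    rw [e, mul_comm, ← div_eq_mul_inv, ENNReal.le_div_iff_mul_le (Or.inl (hne N)) (Or.inl (by simp))]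
    rw [← ENNReal.ofReal_natCast, ← ENNReal.ofReal_natCast, ← ENNReal.ofReal_mul' (hpos N).le]
    exact ENNReal.ofReal_le_ofReal (hy N)
  let P : ℕ → ProbabilityMeasure X := fun N => ⟨ν N, hν N⟩
  let U : Ultrafilter ℕ := hyperfilter ℕ
  have hU : (U : Filter ℕ) ≤ atTop := by
    rw [← Nat.cofinite_eq_atTop]; exact hyperfilter_le_cofinite
  obtain ⟨μ, -, hμ⟩ := (isCompact_univ (X := ProbabilityMeasure X)).ultrafilter_le_nhds
    (U.map P) (by simp)
  have hlim : Tendsto P U (nhds μ) := hμ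
  refine ⟨μ, inferInstance, ⟨hT.measurable, ?_⟩, ?_⟩
  · have := Measure.isProbabilityMeasure_map (μ := (μ : Measure X)) hT.aemeasurable
    refine ext_of_forall_integral_eq_of_IsFiniteMeasure fun f => ?_
    rw [integral_map hT.aemeasurable f.continuous.aestronglyMeasurable]
    have h1 := ProbabilityMeasure.tendsto_iff_forall_integral_tendsto.1 hlim f
    let g := f.compContinuous ⟨T, hT⟩
    have h2 := ProbabilityMeasure.tendsto_iff_forall_integral_tendsto.1 hlim g
    have h3 : Tendsto (fun N => ∫ x, g x ∂(P N : Measure X) - ∫ x, f x ∂(P N : Measure X)) U (nhds 0) := by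
      refine Tendsto.mono_left ?_ hU
      refine squeeze_zero_norm (a := fun N : ℕ => 2 * ‖f‖ * (1 / ((N:ℝ) + 1))) ?_ ?_
      · intro N
        have e : ∫ x, g x ∂(P N : Measure X) - ∫ x, f x ∂(P N : Measure X)
            = (n N : ℝ)⁻¹ * (f (T^[n N] (y N)) - f (y N)) := by
          change ∫ x, g x ∂(ν N) - ∫ x, f x ∂(ν N) = _
          rw [hint, hint, ← mul_sub, ← Finset.sum_sub_distrib]
          congr 1
          have := Finset.sum_range_sub (fun i => f (T^[i] (y N))) (n N)
          simpa [g, Function.iterate_succ_apply'] using this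
        rw [e, norm_mul, mul_comm]
        have b1 : ‖f (T^[n N] (y N)) - f (y N)‖ ≤ 2 * ‖f‖ := by
          have := f.dist_le_two_norm (T^[n N] (y N)) (y N)
          rwa [dist_eq_norm] at this
        have b2 : ‖((n N : ℝ))⁻¹‖ ≤ 1 / ((N:ℝ)+1) := by
          rw [norm_inv, Real.norm_of_nonneg (hpos N).le, ← one_div]
          apply one_div_le_one_div_of_le (by positivity)
          exact_mod_cast hn N
        gcongr
      · have := (tendsto_one_div_add_atTop_nhds_zero_nat (𝕜 := ℝ)).const_mul (2 * ‖f‖)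
        simpa using this
    have h4 := tendsto_nhds_unique h3 (h2.sub h1)
    have : ∫ x, g x ∂(μ : Measure X) = ∫ x, f x ∂(μ : Measure X) := by linarith
    exact this
  · have := ProbabilityMeasure.tendsto_measure_of_null_frontier_of_tendsto' hlim (E := D)
      (by simp [hD.frontier_eq])
    exact ge_of_tendsto' this hDν

theorem card_le_aux (A : Set ℤ) (n : ℕ) (k : ℤ) :
    (Nat.card ↥(A ∩ Set.Ioc k (k + n)) : ℝ) / n ≤ 1 := by
  apply div_le_one_of_le₀ _ (by positivity)
  have : Nat.card ↥(A ∩ Set.Ioc k (k + n)) ≤ Nat.card ↥(Set.Ioc k (k + (n:ℤ))) :=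
    Nat.card_mono (Set.finite_Ioc _ _) Set.inter_subset_right
  have h2 : Nat.card ↥(Set.Ioc k (k + (n:ℤ))) = n := by simp
  rw [h2] at this
  exact_mod_cast this

theorem bdd_aux (A : Set ℤ) (n : ℕ) :
    BddAbove (Set.range fun k : ℤ => (Nat.card ↥(A ∩ Set.Ioc k (k + n)) : ℝ) / n) :=
  ⟨1, by rintro _ ⟨k, rfl⟩; exact card_le_aux A n k⟩

theorem card_eq_aux (A : Set ℤ) (n : ℕ) (k : ℤ) :
    Nat.card ↥(A ∩ Set.Ioc k (k + n)) = Nat.card {i : ℕ // i < n ∧ (k + 1 + i) ∈ A} := by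
  refine Nat.card_congr ⟨fun x => ⟨(x.1 - k - 1).toNat, ?_⟩, fun i => ⟨k + 1 + i.1, ?_⟩, ?_, ?_⟩
  · obtain ⟨x, hx, h1, h2⟩ := x
    refine ⟨by dsimp only; omega, ?_⟩
    convert hx using 1
    dsimp only; omega
  · obtain ⟨i, hi, h⟩ := i
    exact ⟨h, by dsimp only; omega, by dsimp only; omega⟩
  · rintro ⟨x, hx, h1, h2⟩
    apply Subtype.ext; dsimp only; omega
  · rintro ⟨i, hi, h⟩
    apply Subtype.ext; dsimp only; omega

def shS (S : Set ℤ) : Set (ℤ → Bool) := {x | ∀ i j, x i = true → x j = true → i - j ∉ S}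

abbrev ShX (S : Set ℤ) : Type := ↥(shS S)

theorem shX_closed (S : Set ℤ) :
    IsClosed (shS S) := by
  unfold shS
  simp only [Set.ofPred_forall]
  refine isClosed_iInter fun i => isClosed_iInter fun j => ?_
  have : {x : ℤ → Bool | x i = true → x j = true → i - j ∉ S} =
      (fun x : ℤ → Bool => (x i, x j)) ⁻¹' {p | p.1 = true → p.2 = true → i - j ∉ S} := rfl
  rw [this]
  exact (isClosed_discrete _).preimage (by fun_prop)

theorem shS_add {S : Set ℤ} {x : ℤ → Bool} (h : x ∈ shS S) (c : ℤ) :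
    (fun i => x (i + c)) ∈ shS S := fun i j hi hj => by
  have := h _ _ hi hj
  rwa [add_sub_add_right_eq_sub] at this

def shT (S : Set ℤ) : ShX S ≃ₜ ShX S where
  toFun x := ⟨fun i => x.1 (i + 1), shS_add x.2 1⟩
  invFun x := ⟨fun i => x.1 (i + -1), shS_add x.2 (-1)⟩
  left_inv x := by apply Subtype.ext; funext i; simp
  right_inv x := by apply Subtype.ext; funext i; simp
  continuous_toFun := Continuous.subtype_mk (continuous_pi fun i : ℤ =>
    (continuous_apply (i + 1)).comp continuous_subtype_val) fun x => shS_add x.2 1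
  continuous_invFun := Continuous.subtype_mk (continuous_pi fun i : ℤ =>
    (continuous_apply (i + -1)).comp continuous_subtype_val) fun x => shS_add x.2 (-1)

theorem shT_iter (S : Set ℤ) (m : ℕ) (x : ShX S) (i : ℤ) :
    ((shT S)^[m] x).1 i = x.1 (i + m) := by
  induction m generalizing i with
  | zero => simp
  | succ m ih =>
    rw [Function.iterate_succ_apply']
    change ((shT S)^[m] x).1 (i + 1) = _
    rw [ih, add_assoc]; congr 2; push_cast; ring

theorem shT_zpow (S : Set ℤ) (m : ℤ) (x : ShX S) (i : ℤ) :
    (((shT S).toMeasurableEquiv.toEquiv ^ m : Equiv.Perm (ShX S)) x).1 i = x.1 (i + m) := by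
  induction m generalizing i with
  | zero => simp
  | succ m ih =>
    rw [add_comm, zpow_add, zpow_one]
    change (((shT S).toMeasurableEquiv.toEquiv ^ (m:ℤ) : Equiv.Perm (ShX S)) x).1 (i + 1) = _
    rw [ih, add_assoc]
  | pred m ih =>
    rw [sub_eq_neg_add, zpow_add, zpow_neg_one]
    change (((shT S).toMeasurableEquiv.toEquiv ^ (-m:ℤ) : Equiv.Perm (ShX S)) x).1 (i + -1) = _
    rw [ih, add_assoc]

theorem forward_aux (S : Set ℤ) (δ : ℝ) (A : Set ℤ) (hA : δ < upperBanachDensity A)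
    (hδ : 0 ≤ δ) (hS : (A - A) ∩ S = ∅) :
      (∃ (X : Type) (_ : MeasurableSpace X) (μ : Measure X)
          (_ : IsProbabilityMeasure μ) (T : X ≃ᵐ X) (_ : MeasurePreserving T μ μ)
          (D : Set X), MeasurableSet D ∧ ENNReal.ofReal δ < μ D ∧
            ∀ n ∈ S, D ∩ ⇑(T.toEquiv ^ n) '' D = ∅) := by
  classical
  obtain ⟨c, hc1, hc2⟩ := exists_between hA
  have hfr : ∃ᶠ n : ℕ in atTop, c < ⨆ k : ℤ, (Nat.card ↥(A ∩ Set.Ioc k (k + n)) : ℝ) / n := by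
    refine frequently_lt_of_lt_limsup ?_ hc2
    refine IsCoboundedUnder.of_frequently_ge (a := 0) ?_
    refine Frequently.of_forall fun n => ?_
    exact Real.iSup_nonneg fun k => div_nonneg (Nat.cast_nonneg _) (Nat.cast_nonneg _)
  have : CompactSpace (ShX S) := isCompact_iff_compactSpace.1 (shX_closed S).isCompact
  let D : Set (ShX S) := {x | x.1 0 = true}
  have hD : IsClopen D := by
    have : D = (fun x : ShX S => x.1 0) ⁻¹' {true} := rfl
    rw [this]
    exact (isClopen_discrete _).preimage ((continuous_apply 0).comp continuous_subtype_val)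
  obtain ⟨μ, h1, h2, h3⟩ := avg_aux (shT S) (shT S).continuous D hD c (by
    intro N
    obtain ⟨n, hn, hn2⟩ := frequently_atTop.1 hfr (N + 1)
    obtain ⟨k, hk⟩ := exists_lt_of_lt_ciSup hn2
    refine ⟨n, by omega, ⟨fun i => decide (k + 1 + i ∈ A), ?_⟩, ?_⟩
    · intro i j hi hj hij
      simp only [decide_eq_true_eq] at hi hj
      have : i - j ∈ (A - A) ∩ S :=
        ⟨⟨_, hi, _, hj, by dsimp only; ring⟩, hij⟩
      rw [hS] at this; exact this
    · have hn0 : (0:ℝ) < n := by exact_mod_cast (by omega : 0 < n)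
      rw [lt_div_iff₀ hn0, card_eq_aux] at hk
      refine hk.le.trans (le_of_eq ?_)
      congr 2
      simp only [D, Set.mem_ofPred_eq, shT_iter]
      simp)
  refine ⟨ShX S, inferInstance, μ, h1, (shT S).toMeasurableEquiv, h2, D, hD.1.measurableSet,
    lt_of_lt_of_le ?_ h3, ?_⟩
  · exact (ENNReal.ofReal_lt_ofReal_iff (by linarith)).2 hc1
  · intro n hn
    rw [Set.eq_empty_iff_forall_notMem]
    rintro _ ⟨hx, y, hy, rfl⟩
    simp only [D, Set.mem_ofPred_eq] at hx hy
    have hx' := (shT_zpow S n y 0).symm.trans hx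
    exact y.2 _ _ hx' hy (by simpa using hn)

theorem backward_aux (S : Set ℤ) (δ : ℝ) (hδ : 0 ≤ δ) (X : Type) [MeasurableSpace X] (μ : Measure X)
    [IsProbabilityMeasure μ] (T : X ≃ᵐ X) (hT : MeasurePreserving T μ μ)
    (D : Set X) (hD : MeasurableSet D) (hμ : ENNReal.ofReal δ < μ D)
    (hS : ∀ n ∈ S, D ∩ ⇑(T.toEquiv ^ n) '' D = ∅) :
    ∃ A : Set ℤ, δ < upperBanachDensity A ∧ (A - A) ∩ S = ∅ := by
  classical
  let A : X → Set ℤ := fun x => {m | (T.toEquiv ^ m : Equiv.Perm X) x ∈ D}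
  suffices h : ∃ x, δ < upperBanachDensity (A x) by
    obtain ⟨x, hx⟩ := h
    refine ⟨A x, hx, ?_⟩
    rw [Set.eq_empty_iff_forall_notMem]
    rintro _ ⟨⟨a, ha, b, hb, rfl⟩, hs⟩
    have := hS _ hs
    rw [Set.eq_empty_iff_forall_notMem] at this
    refine this _ ⟨ha, _, hb, ?_⟩
    rw [← Equiv.Perm.mul_apply, ← zpow_add]
    simp
  by_contra hcon
  push Not at hcon
  obtain ⟨e, he1, he2⟩ := exists_between hμ
  lift e to NNReal using he2.ne_top
  have he1' : δ < e := by
    rw [← ENNReal.ofReal_coe_nnreal] at he1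
    exact (ENNReal.ofReal_lt_ofReal_iff_of_nonneg hδ).1 he1
  let f : ℕ → X → ENNReal := fun n x =>
    ((n:ENNReal) + 1)⁻¹ * ∑ i ∈ Finset.range (n+1), D.indicator 1 (T^[i+1] x)
  have hm : ∀ i, MeasurePreserving (T^[i]) μ μ := fun i => hT.iterate i
  have hmeas : ∀ i, Measurable fun x => D.indicator (1 : X → ENNReal) (T^[i+1] x) := fun i =>
    (measurable_one.indicator hD).comp (hm (i+1)).measurable
  have hne : ∀ n : ℕ, (n:ENNReal) + 1 ≠ 0 := fun n => by simp
  have hnt : ∀ n : ℕ, (n:ENNReal) + 1 ≠ ⊤ := fun n => by simp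
  have hfm : ∀ n, Measurable (f n) := fun n => by
    exact (Finset.measurable_fun_sum _ fun i _ => hmeas i).const_mul _
  have hfi : ∀ n, ∫⁻ x, f n x ∂μ = μ D := by
    intro n
    simp only [f]
    rw [lintegral_const_mul _ (Finset.measurable_fun_sum _ fun i _ => hmeas i),
      lintegral_finsetSum _ (fun i _ => hmeas i)]
    have : ∀ i, ∫⁻ x, D.indicator (1 : X → ENNReal) (T^[i+1] x) ∂μ = μ D := by
      intro i
      rw [(hm (i+1)).lintegral_comp (measurable_one.indicator hD), lintegral_indicator_one hD]
    simp only [this, Finset.sum_const, Finset.card_range, nsmul_eq_mul]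
    push_cast
    rw [← mul_assoc, ENNReal.inv_mul_cancel (hne n) (hnt n), one_mul]
  have hfe : ∀ n x, f n x = ENNReal.ofReal
      ((Nat.card ↥(A x ∩ Set.Ioc 0 (0 + ((n+1 : ℕ) : ℤ))) : ℝ) / (n+1 : ℕ)) := by
    intro n x
    have hc : Nat.card {i : ℕ // i < n + 1 ∧ ((0:ℤ) + 1 + i) ∈ A x} =
          ((Finset.range (n+1)).filter (fun i => T^[i+1] x ∈ D)).card := by
      rw [← Nat.card_eq_finsetCard]
      congr 1
      simp only [Finset.mem_filter, Finset.mem_range, A, Set.mem_ofPred_eq]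
      congr! 4 with i
      rw [show (0:ℤ) + 1 + i = ((i + 1 : ℕ) : ℤ) by push_cast; ring, zpow_natCast,
        Equiv.Perm.coe_pow]
      rfl
    rw [card_eq_aux, hc, ENNReal.ofReal_div_of_pos (by positivity), ENNReal.ofReal_natCast,
      ENNReal.ofReal_natCast, div_eq_mul_inv, mul_comm, Finset.card_filter]
    simp only [f]
    push_cast
    congr 1
  have hlim : ∀ x, limsup (fun n => f n x) atTop ≤ e := by
    intro x
    have h1 : ∀ᶠ n : ℕ in atTop, ⨆ k : ℤ, (Nat.card ↥(A x ∩ Set.Ioc k (k + n)) : ℝ) / n < e := by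
      refine eventually_lt_of_limsup_lt ((hcon x).trans_lt he1') ?_
      refine ⟨1, eventually_map.2 (Eventually.of_forall fun n => ?_)⟩
      exact ciSup_le fun k => card_le_aux _ _ _
    refine limsup_le_of_le (by isBoundedDefault) ?_
    filter_upwards [(tendsto_add_atTop_nat 1).eventually h1] with n hn
    rw [hfe, ← ENNReal.ofReal_coe_nnreal]
    exact ENNReal.ofReal_le_ofReal ((le_ciSup (bdd_aux (A x) (n+1)) 0).trans hn.le)
  have hfin := limsup_lintegral_le (μ := μ) (f := f) 1 hfm (fun n => by
    refine Eventually.of_forall fun x => ?_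
    rw [hfe]
    exact (ENNReal.ofReal_le_ofReal (card_le_aux _ _ _)).trans (by simp)) (by simp)
  simp only [hfi, limsup_const] at hfin
  have : ∫⁻ x, limsup (fun n => f n x) atTop ∂μ ≤ ∫⁻ x, (e : ENNReal) ∂μ :=
    lintegral_mono hlim
  simp only [lintegral_const, measure_univ, mul_one] at this
  exact absurd (hfin.trans this) (not_le.2 he2)

theorem stmt3 (S : Set ℤ) (δ : ℝ) (hδ : 0 ≤ δ) :
    (∃ A : Set ℤ, δ < upperBanachDensity A ∧ (A - A) ∩ S = ∅) ↔
      (∃ (X : Type) (_ : MeasurableSpace X) (μ : Measure X)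
          (_ : IsProbabilityMeasure μ) (T : X ≃ᵐ X) (_ : MeasurePreserving T μ μ)
          (D : Set X), MeasurableSet D ∧ ENNReal.ofReal δ < μ D ∧
            ∀ n ∈ S, D ∩ ⇑(T.toEquiv ^ n) '' D = ∅) := by
  constructor
  · rintro ⟨A, hA, hS⟩
    exact forward_aux S δ A hA hδ hS
  · rintro ⟨X, _, μ, _, T, hT, D, hD, hμ, hS⟩
    exact backward_aux S δ hδ X μ T hT D hD hμ hS
end

section
/- Let S ⊆ ℤ and 0 ≤ δ < δ′. If every finite subset of S is δ′-nonrecurrent, then S is δ-nonrecurrent. -/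
open MeasureTheory Filter Pointwise

/-- A set `S ⊆ ℤ` is `δ`-nonrecurrent if there is `A ⊆ ℤ` with upper Banach density
`d*(A) > δ` such that `(A - A) ∩ S = ∅`. -/
def Nonrecurrent (δ : ℝ) (S : Set ℤ) : Prop :=
  ∃ A : Set ℤ, δ < upperBanachDensity A ∧ (A - A) ∩ S = ∅

lemma aux_fin (A : Set ℤ) (k l : ℤ) : (A ∩ Set.Ioc k l).Finite :=
  (Set.finite_Ioc k l).subset Set.inter_subset_right

lemma aux_card_le (A : Set ℤ) (k : ℤ) (n : ℕ) :
    Nat.card ↥(A ∩ Set.Ioc k (k + n)) ≤ n := by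
  have h := Set.ncard_le_ncard (Set.inter_subset_right : A ∩ Set.Ioc k (k + n) ⊆ _)
    (Set.finite_Ioc k (k + n))
  rw [Nat.card_coe_set_eq]
  refine h.trans ?_
  rw [← Finset.coe_Ioc, Set.ncard_coe_finset]
  simp

lemma aux_le_one (A : Set ℤ) (k : ℤ) (n : ℕ) :
    (Nat.card ↥(A ∩ Set.Ioc k (k + n)) : ℝ) / n ≤ 1 := by
  apply div_le_one_of_le₀ _ (Nat.cast_nonneg n)
  exact_mod_cast aux_card_le A k n

lemma aux_split (A : Set ℤ) (k : ℤ) (m n : ℕ) (hmn : m ≤ n) :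
    Nat.card ↥(A ∩ Set.Ioc k (k + n)) ≤ Nat.card ↥(A ∩ Set.Ioc k (k + m)) +
      Nat.card ↥(A ∩ Set.Ioc (k + m) (k + m + (n - m : ℕ))) := by
  simp only [Nat.card_coe_set_eq]
  refine le_trans (Set.ncard_le_ncard ?_ ((aux_fin _ _ _).union (aux_fin _ _ _)))
    (Set.ncard_union_le _ _)
  rintro x ⟨hx, h1, h2⟩
  by_cases hxm : x ≤ k + m
  · exact Or.inl ⟨hx, h1, hxm⟩
  · exact Or.inr ⟨hx, by omega, by omega⟩

lemma aux_prefix (A : Set ℤ) (d : ℝ) (h0 : 0 ≤ d) (hd : d < upperBanachDensity A) (N : ℕ) :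
    ∃ t : ℤ, ∀ n : ℕ, 1 ≤ n → n ≤ N → d * n ≤ Nat.card ↥(A ∩ Set.Ioc t (t + n)) := by
  by_contra! hc
  have key : ∀ M : ℕ, ∀ t : ℤ, (Nat.card ↥(A ∩ Set.Ioc t (t + M)) : ℝ) ≤ d * M + N := by
    intro M
    induction M using Nat.strong_induction_on with
    | _ M ih =>
      intro t
      by_cases hM : M ≤ N
      · have h1 : (Nat.card ↥(A ∩ Set.Ioc t (t + M)) : ℝ) ≤ M := by
          exact_mod_cast aux_card_le A t M
        have h2 : (M : ℝ) ≤ N := by exact_mod_cast hM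
        have h3 : 0 ≤ d * M := by positivity
        linarith
      · obtain ⟨n, hn1, hnN, hn⟩ := hc t
        have h1 := ih (M - n) (by omega) (t + n)
        have h2 : (Nat.card ↥(A ∩ Set.Ioc t (t + M)) : ℝ) ≤
            Nat.card ↥(A ∩ Set.Ioc t (t + n)) +
            Nat.card ↥(A ∩ Set.Ioc (t + n) (t + n + (M - n : ℕ))) := by
          exact_mod_cast aux_split A t n M (by omega)
        have h3 : ((M - n : ℕ) : ℝ) = M - n := Nat.cast_sub (by omega)
        rw [h3] at h1
        linarith
  obtain ⟨e, he1, he2⟩ := exists_between hd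
  have hlim : Tendsto (fun M : ℕ => (N : ℝ) / M) atTop (nhds 0) :=
    tendsto_const_div_atTop_nhds_zero_nat _
  have hev : ∀ᶠ M : ℕ in atTop,
      (⨆ k : ℤ, (Nat.card ↥(A ∩ Set.Ioc k (k + M)) : ℝ) / M) ≤ e := by
    filter_upwards [hlim.eventually_lt_const (sub_pos.2 he1), eventually_gt_atTop 0] with M h1 h2
    apply ciSup_le
    intro k
    have hM : (0 : ℝ) < M := by exact_mod_cast h2
    rw [div_lt_iff₀ hM] at h1
    rw [div_le_iff₀ hM]
    linarith [key M k]
  have : upperBanachDensity A ≤ e := by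
    refine limsup_le_of_le ?_ hev
    refine IsCoboundedUnder.of_frequently_ge (a := 0) (Frequently.of_forall fun n => ?_)
    exact Real.iSup_nonneg fun k => by positivity
  linarith

theorem stmt4 (S : Set ℤ) (δ δ' : ℝ) (h0 : 0 ≤ δ) (hδ : δ < δ')
    (h : ∀ F : Set ℤ, F.Finite → F ⊆ S → Nonrecurrent δ' F) :
    Nonrecurrent δ S := by
  have hN : ∀ N : ℕ, ∃ B : Set ℤ, (∀ n : ℕ, 1 ≤ n → n ≤ N →
      δ' * n ≤ Nat.card ↥(B ∩ Set.Ioc (0 : ℤ) (0 + n))) ∧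
      ∀ x ∈ B, ∀ y ∈ B, x - y ∈ S → ¬ |x - y| ≤ N := by
    intro N
    obtain ⟨A, hA, hAF⟩ := h (S ∩ Set.Icc (-N : ℤ) N)
      ((Set.finite_Icc _ _).subset Set.inter_subset_right) Set.inter_subset_left
    obtain ⟨t, ht⟩ := aux_prefix A δ' (by linarith) hA N
    refine ⟨{x | x + t ∈ A}, fun n h1 h2 => (ht n h1 h2).trans ?_, ?_⟩
    · norm_cast
      simp only [Nat.card_coe_set_eq]
      refine Set.ncard_le_ncard_of_injOn (fun x => x - t) ?_ ?_ (aux_fin _ _ _)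
      · rintro x ⟨hx, h1, h2⟩
        refine ⟨by simpa using hx, ?_, ?_⟩ <;> push_cast at * <;> omega
      · intro x _ y _ hxy
        simpa using hxy
    · intro x hx y hy hS habs
      have : x - y ∈ (A - A) ∩ (S ∩ Set.Icc (-N : ℤ) N) :=
        ⟨⟨x + t, hx, y + t, hy, by simp⟩, hS, abs_le.1 habs⟩
      rw [hAF] at this
      exact this
  choose B hB1 hB2 using hN
  let U : Ultrafilter ℕ := hyperfilter ℕ
  have hU : ∀ m : ℕ, ∀ᶠ N in (U : Filter ℕ), m ≤ N := fun m =>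
    (Nat.hyperfilter_le_atTop) (eventually_ge_atTop m)
  refine ⟨{x | ∀ᶠ N in (U : Filter ℕ), x ∈ B N}, ?_, ?_⟩
  · set C : Set ℤ := {x | ∀ᶠ N in (U : Filter ℕ), x ∈ B N} with hC
    have hcard : ∀ n : ℕ, 1 ≤ n → δ' * n ≤ Nat.card ↥(C ∩ Set.Ioc (0 : ℤ) (0 + n)) := by
      intro n hn
      have h1 : ∀ᶠ N in (U : Filter ℕ), ∀ x ∈ Set.Ioc (0 : ℤ) (0 + n), (x ∈ B N → x ∈ C) := by
        rw [eventually_all_finite (Set.finite_Ioc _ _)]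
        intro x _
        by_cases hx : x ∈ C
        · exact Eventually.of_forall fun _ _ => hx
        · have : ∀ᶠ N in (U : Filter ℕ), ¬ x ∈ B N := Ultrafilter.eventually_not.2 hx
          filter_upwards [this] with N h1 h2 using absurd h2 h1
      obtain ⟨N, h1, h2⟩ := (h1.and (hU n)).exists
      refine (hB1 N n hn h2).trans ?_
      simp only [Nat.card_coe_set_eq]
      have hsub : B N ∩ Set.Ioc (0 : ℤ) (0 + n) ⊆ C ∩ Set.Ioc (0 : ℤ) (0 + n) :=
        fun x hx => ⟨h1 x hx.2 hx.1, hx.2⟩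
      exact Nat.cast_le.2 (Set.ncard_le_ncard hsub (aux_fin _ _ _))
    refine hδ.trans_le (le_limsup_of_frequently_le (Eventually.frequently ?_) ?_)
    · filter_upwards [eventually_ge_atTop 1] with n hn
      have hn' : (0 : ℝ) < n := by exact_mod_cast hn
      refine le_trans ?_ (le_ciSup (f := fun k : ℤ =>
        (Nat.card ↥(C ∩ Set.Ioc k (k + n)) : ℝ) / n)
        ⟨1, by rintro _ ⟨k, rfl⟩; exact aux_le_one C k n⟩ 0)
      rw [le_div_iff₀ hn']
      exact hcard n hn
    · exact isBoundedUnder_of ⟨1, fun n => ciSup_le fun k => aux_le_one C k n⟩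
  · rw [Set.eq_empty_iff_forall_notMem]
    rintro _ ⟨⟨x, hx, y, hy, rfl⟩, hS⟩
    obtain ⟨N, ⟨h1, h2⟩, h3⟩ := ((hx.and hy).and (hU (x - y).natAbs)).exists
    exact hB2 N x h1 y h2 hS (by rw [Int.abs_eq_natAbs]; exact_mod_cast h3)
end

section
/- Let (X, μ, T) be a measure preserving system, N ∈ ℕ, δ > 0, and S ⊆ ℤ a finite set. Let E ⊆ E′ ⊆ X be measurable sets such that the sets E, TE, …, T^{N−1}E are mutually disjoint and the sets E′, TE′, …, T^{N−1}E′ are mutually disjoint, and let S′ := {n ∈ ℤ : TⁿE ⊆ E′}. If there is a set A ⊆ {0, …, N−1} with A + S ⊆ {0, …, N−1}, A ∩ (A + S) = ∅, and |A|·μ(E) > δ, then there is a measurable set D ⊆ X with μ(D) > δ such that D ∩ TⁿD = ∅ for all n ∈ S ∪ (S + S′); in particular S ∪ (S + S′) is δ-nonrecurrent. -/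
open MeasureTheory Filter Pointwise ENNReal

theorem mp_zpow_aux {X : Type} [MeasurableSpace X] (μ : Measure X)
    (T : X ≃ᵐ X) (hT : MeasurePreserving T μ μ) (k : ℤ) :
    MeasurePreserving (⇑((T.toEquiv : Equiv.Perm X) ^ k)) μ μ := by
  induction k with
  | zero => simpa using MeasurePreserving.id μ
  | succ k ih =>
    rw [zpow_add_one]
    exact ih.comp hT
  | pred k ih =>
    rw [zpow_sub_one]
    exact ih.comp (hT.symm T)

theorem img_zpow_aux {X : Type} (P : Equiv.Perm X) (k : ℤ) (D : Set X) :
    ⇑(P ^ k) '' D = ⇑(P ^ (-k)) ⁻¹' D := by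
  rw [zpow_neg, Equiv.image_eq_preimage_symm]
  rfl

theorem density_aux {X : Type} [MeasurableSpace X] (μ : Measure X) [IsProbabilityMeasure μ]
    (P : Equiv.Perm X) (hP : ∀ k : ℤ, MeasurePreserving (⇑(P ^ k)) μ μ)
    (δ : ℝ) (hδ : 0 < δ) (D : Set X) (hD : MeasurableSet D) (h : ENNReal.ofReal δ < μ D) :
    ∃ x : X, δ < upperBanachDensity {k : ℤ | (P ^ k) x ∈ D} := by
  classical
  let f : ℕ → X → ℝ≥0∞ := fun n x =>
    (∑ k ∈ Finset.Ioc (0 : ℤ) n, D.indicator (fun _ => (1 : ℝ≥0∞)) ((P ^ k) x)) / n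
  have hmeas1 : ∀ k : ℤ, Measurable fun x => D.indicator (fun _ => (1 : ℝ≥0∞)) ((P ^ k) x) :=
    fun k => (measurable_const.indicator hD).comp (hP k).measurable
  have hf : ∀ n, Measurable (f n) := fun n =>
    (Finset.measurable_sum _ fun k _ => hmeas1 k).div_const _
  have hcount : ∀ n x, f n x =
      ((Nat.card ↥({k : ℤ | (P ^ k) x ∈ D} ∩ Set.Ioc 0 (0 + (n : ℤ))) : ℕ) : ℝ≥0∞) / n := by
    intro n x
    have : ({k : ℤ | (P ^ k) x ∈ D} ∩ Set.Ioc 0 (0 + (n : ℤ))) =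
        ↑((Finset.Ioc (0 : ℤ) n).filter fun k => (P ^ k) x ∈ D) := by
      ext k; simp [and_comm]
    rw [this]
    simp only [f, Set.indicator_apply]
    rw [Finset.sum_boole, Nat.card_coe_set_eq, Set.ncard_coe_finset]
  have hcardle : ∀ (B : Set ℤ) (k : ℤ) (n : ℕ),
      Nat.card ↥(B ∩ Set.Ioc k (k + (n : ℤ))) ≤ n := by
    intro B k n
    have := Set.ncard_le_ncard (s := B ∩ Set.Ioc k (k + (n : ℤ)))
      (t := Set.Ioc k (k + (n : ℤ))) Set.inter_subset_right (Set.finite_Ioc _ _)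
    rw [← Nat.card_coe_set_eq, ← Nat.card_coe_set_eq] at this
    simpa using this
  have hle1 : ∀ n x, f n x ≤ 1 := by
    intro n x
    rw [hcount]
    refine ENNReal.div_le_of_le_mul ?_
    rw [one_mul]
    exact_mod_cast hcardle _ 0 n
  have hint : ∀ n : ℕ, 0 < n → ∫⁻ x, f n x ∂μ = μ D := by
    intro n hn
    simp only [f, div_eq_mul_inv]
    rw [lintegral_mul_const _ (Finset.measurable_sum _ fun k _ => hmeas1 k),
      lintegral_finsetSum _ fun k _ => hmeas1 k]
    have : ∀ k : ℤ, ∫⁻ x, D.indicator (fun _ => (1 : ℝ≥0∞)) ((P ^ k) x) ∂μ = μ D := by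
      intro k
      rw [(hP k).lintegral_comp (measurable_const.indicator hD)]
      simp [hD]
    simp only [this]
    simp only [Finset.sum_const, Int.card_Ioc, sub_zero, Int.toNat_natCast, nsmul_eq_mul]
    rw [mul_comm, ← mul_assoc, ENNReal.inv_mul_cancel, one_mul]
    · exact_mod_cast hn.ne'
    · simp
  have hfatou : μ D ≤ ∫⁻ x, limsup (fun n => f n x) atTop ∂μ := by
    have h1 := limsup_lintegral_le (μ := μ) (f := f) (fun _ => 1) hf
      (fun n => Filter.Eventually.of_forall fun x => hle1 n x) (by simp)
    refine le_trans (le_of_eq ?_) h1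
    have : (fun n => ∫⁻ x, f n x ∂μ) =ᶠ[atTop] fun _ => μ D := by
      filter_upwards [eventually_gt_atTop 0] with n hn using hint n hn
    rw [limsup_congr this]
    simp
  obtain ⟨x, hx⟩ : ∃ x, ENNReal.ofReal δ < limsup (fun n => f n x) atTop := by
    by_contra! hcon
    have : ∫⁻ x, limsup (fun n => f n x) atTop ∂μ ≤ ∫⁻ x, ENNReal.ofReal δ ∂μ :=
      lintegral_mono hcon
    simp at this
    exact absurd (hfatou.trans this) (not_le.mpr h)
  refine ⟨x, ?_⟩
  set B : Set ℤ := {k : ℤ | (P ^ k) x ∈ D} with hB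
  obtain ⟨r, hr1, hr2⟩ := exists_between hx
  have hrtop : r ≠ ⊤ := hr2.ne_top
  have hfreq := frequently_lt_of_lt_limsup (by isBoundedDefault) hr2
  have hdiv : ∀ (k : ℤ) (n : ℕ), (Nat.card ↥(B ∩ Set.Ioc k (k + n)) : ℝ) / n ≤ 1 := by
    intro k n
    refine div_le_one_of_le₀ ?_ (by positivity)
    exact_mod_cast hcardle B k n
  have hδr : δ < r.toReal := by
    rwa [← ENNReal.ofReal_lt_iff_lt_toReal hδ.le hrtop]
  refine hδr.trans_le ?_
  unfold upperBanachDensity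
  refine le_limsup_of_frequently_le ?_ ?_
  · refine hfreq.mono fun n hn => ?_
    have hb : BddAbove (Set.range fun k : ℤ => (Nat.card ↥(B ∩ Set.Ioc k (k + n)) : ℝ) / n) :=
      ⟨1, by rintro _ ⟨k, rfl⟩; exact hdiv k n⟩
    refine le_trans ?_ (le_ciSup hb 0)
    rw [hcount] at hn
    have h2 : (((Nat.card ↥(B ∩ Set.Ioc 0 (0 + (n : ℤ))) : ℕ) : ℝ≥0∞) / n) ≠ ⊤ := by
      rw [hB, ← hcount]
      exact ((hle1 n x).trans_lt ENNReal.one_lt_top).ne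
    have h3 := ENNReal.toReal_mono h2 hn.le
    simpa [ENNReal.toReal_div] using h3
  · refine ⟨1, ?_⟩
    rw [eventually_map]
    exact Filter.Eventually.of_forall fun n => ciSup_le fun k => hdiv k n

theorem stmt5 (X : Type) [MeasurableSpace X] (μ : Measure X) [IsProbabilityMeasure μ]
    (T : X ≃ᵐ X) (hT : MeasurePreserving T μ μ)
    (N : ℕ) (δ : ℝ) (hδ : 0 < δ) (S : Set ℤ) (hSfin : S.Finite)
    (E E' : Set X) (hE : MeasurableSet E) (hE' : MeasurableSet E') (hEE' : E ⊆ E')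
    -- the sets E, TE, …, T^{N-1}E are mutually disjoint
    (hTower : ∀ i j : ℕ, i < N → j < N → i ≠ j →
      Disjoint (⇑(T.toEquiv ^ (i : ℤ)) '' E) (⇑(T.toEquiv ^ (j : ℤ)) '' E))
    -- the sets E', TE', …, T^{N-1}E' are mutually disjoint
    (hTower' : ∀ i j : ℕ, i < N → j < N → i ≠ j →
      Disjoint (⇑(T.toEquiv ^ (i : ℤ)) '' E') (⇑(T.toEquiv ^ (j : ℤ)) '' E'))
    (A : Finset ℤ) (hA : (↑A : Set ℤ) ⊆ Set.Ico (0 : ℤ) N)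
    (hAS : (↑A + S : Set ℤ) ⊆ Set.Ico (0 : ℤ) N)
    (hAdisj : (↑A ∩ (↑A + S) : Set ℤ) = ∅)
    (hcard : ENNReal.ofReal δ < (A.card : ℝ≥0∞) * μ E) :
    (∃ D : Set X, MeasurableSet D ∧ ENNReal.ofReal δ < μ D ∧
        ∀ n ∈ S ∪ (S + {n : ℤ | ⇑(T.toEquiv ^ n) '' E ⊆ E'}),
          D ∩ ⇑(T.toEquiv ^ n) '' D = ∅) ∧
      Nonrecurrent δ (S ∪ (S + {n : ℤ | ⇑(T.toEquiv ^ n) '' E ⊆ E'})) := by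
  have hP := mp_zpow_aux μ T hT
  set P : Equiv.Perm X := T.toEquiv with hPdef
  have himm : ∀ k : ℤ, MeasurableSet (⇑(P ^ k) '' E) := by
    intro k
    rw [img_zpow_aux]
    exact (hP _).measurable hE
  have himu : ∀ k : ℤ, μ (⇑(P ^ k) '' E) = μ E := by
    intro k
    rw [img_zpow_aux]
    exact (hP _).measure_preimage hE.nullMeasurableSet
  have key : ∀ (F : Set X), (∀ i j : ℕ, i < N → j < N → i ≠ j →
      Disjoint (⇑(P ^ (i : ℤ)) '' F) (⇑(P ^ (j : ℤ)) '' F)) →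
      ∀ a b : ℤ, a ∈ Set.Ico (0 : ℤ) N → b ∈ Set.Ico (0 : ℤ) N → a ≠ b →
        Disjoint (⇑(P ^ a) '' F) (⇑(P ^ b) '' F) := by
    intro F hF a b ha hb hab
    have := hF a.toNat b.toNat (by have := ha.1; have := ha.2; omega)
      (by have := hb.1; have := hb.2; omega)
      (by have := hb.1; have := ha.1; omega)
    rwa [Int.toNat_of_nonneg ha.1, Int.toNat_of_nonneg hb.1] at this
  have hD : ∃ D : Set X, MeasurableSet D ∧ ENNReal.ofReal δ < μ D ∧
        ∀ n ∈ S ∪ (S + {n : ℤ | ⇑(P ^ n) '' E ⊆ E'}),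
          D ∩ ⇑(P ^ n) '' D = ∅ := by
    refine ⟨⋃ a ∈ A, ⇑(P ^ a) '' E, Finset.measurableSet_biUnion _ fun a _ => himm a, ?_, ?_⟩
    · rw [measure_biUnion_finset _ fun a _ => himm a]
      · simpa [himu] using hcard
      · intro a ha b hb hab
        exact key E hTower a b (hA ha) (hA hb) hab
    · intro n hn
      have hn' : ∃ s ∈ S, ∃ m : ℤ, ⇑(P ^ m) '' E ⊆ E' ∧ n = s + m := by
        rcases hn with hn | hn
        · exact ⟨n, hn, 0, by simpa using hEE', by simp⟩
        · obtain ⟨s, hs, m, hm, rfl⟩ := Set.mem_add.mp hn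
          exact ⟨s, hs, m, hm, rfl⟩
      obtain ⟨s, hs, m, hm, rfl⟩ := hn'
      rw [Set.eq_empty_iff_forall_notMem]
      rintro x ⟨hx1, y, hy, hyx⟩
      simp only [Set.mem_iUnion] at hx1 hy
      obtain ⟨a, ha, e, he, hex⟩ := hx1
      obtain ⟨b, hb, e2, he2, rfl⟩ := hy
      have hbs : b + s ∈ (↑A + S : Set ℤ) := Set.add_mem_add hb hs
      have hne : a ≠ b + s := by
        rintro rfl
        have : b + s ∈ (↑A ∩ (↑A + S) : Set ℤ) := ⟨ha, hbs⟩
        rw [hAdisj] at this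
        exact this
      refine Set.disjoint_left.mp (key E' hTower' a (b + s) (hA ha) (hAS hbs) hne)
        ⟨e, hEE' he, hex⟩ ⟨(P ^ m) e2, hm ⟨e2, he2, rfl⟩, ?_⟩
      rw [← hyx, ← Equiv.Perm.mul_apply, ← Equiv.Perm.mul_apply, ← zpow_add, ← zpow_add]
      congr 2
      ring
  refine ⟨hD, ?_⟩
  obtain ⟨D, hDm, hDδ, hDn⟩ := hD
  obtain ⟨x, hx⟩ := density_aux μ P hP δ hδ D hDm hDδ
  refine ⟨_, hx, ?_⟩
  rw [Set.eq_empty_iff_forall_notMem]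
  rintro n ⟨hn1, hn2⟩
  obtain ⟨k, hk, l, hl, rfl⟩ := Set.mem_sub.mp hn1
  have hh := hDn _ hn2
  rw [Set.eq_empty_iff_forall_notMem] at hh
  refine hh ((P ^ k) x) ⟨hk, (P ^ l) x, hl, ?_⟩
  rw [← Equiv.Perm.mul_apply, ← zpow_add]
  simp
end

section
/- Let d ∈ ℕ. If S ⊆ ℤ is d-Bohr dense, then for every M ∈ ℕ and every ε > 0 there is a finite subset S′ ⊆ S such that for every m ∈ ℤ with |m| ≤ M, the translate S′ − m is (d, ε)-Bohr recurrent. -/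
open Filter Pointwise

/-- `S` is `(d, ε)`-Bohr recurrent if for every `α ∈ 𝕋^d` there is `s ∈ S`
with `‖sα‖ < ε`, i.e. `‖s • α j‖ < ε` for every coordinate `j`. -/
def BohrRecurrentAt (d : ℕ) (ε : ℝ) (S : Set ℤ) : Prop :=
  ∀ α : Fin d → AddCircle (1 : ℝ), ∃ s ∈ S, ∀ j, ‖(s • α) j‖ < ε

/-- `S` is `d`-Bohr dense if `S` meets every nonempty Bohr neighborhood
`B(α;U) = {n : nα ∈ U}` of rank at most `d`. -/
def BohrDenseRank (d : ℕ) (S : Set ℤ) : Prop :=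
  ∀ e : ℕ, e ≤ d → ∀ α : Fin e → AddCircle (1 : ℝ),
    ∀ U : Set (Fin e → AddCircle (1 : ℝ)), IsOpen U → (∃ n : ℤ, n • α ∈ U) →
      ∃ s ∈ S, s • α ∈ U

theorem stmt7 (d : ℕ) (S : Set ℤ) (hS : BohrDenseRank d S) (M : ℕ) (ε : ℝ) (hε : 0 < ε) :
    ∃ S' : Set ℤ, S' ⊆ S ∧ S'.Finite ∧
      ∀ m : ℤ, |m| ≤ (M : ℤ) → BohrRecurrentAt d ε ((fun s => s - m) '' S') := by
  have key : ∀ m : ℤ, ∃ T : Set ℤ, T ⊆ S ∧ T.Finite ∧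
      BohrRecurrentAt d ε ((fun s => s - m) '' T) := by
    intro m
    have hopen : ∀ k : ℤ, IsOpen {α : Fin d → AddCircle (1 : ℝ) | ∀ j, ‖(k • α) j‖ < ε} := by
      intro k
      simp only [Set.setOf_forall]
      refine isOpen_iInter_of_finite fun j => ?_
      refine isOpen_lt ?_ continuous_const
      exact ((continuous_apply j).comp (continuous_zsmul k)).norm
    have : Fact ((0 : ℝ) < 1) := ⟨one_pos⟩
    obtain ⟨t, ht⟩ := (isCompact_univ (X := Fin d → AddCircle (1 : ℝ))).elim_finite_subcover
      (fun s : S => {α : Fin d → AddCircle (1 : ℝ) | ∀ j, ‖(((s : ℤ) - m) • α) j‖ < ε})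
      (fun s => hopen _) (by
        intro α _
        have hU : IsOpen {x : Fin d → AddCircle (1 : ℝ) | ∀ j, ‖x j - (m • α) j‖ < ε} := by
          simp only [Set.setOf_forall]
          refine isOpen_iInter_of_finite fun j => ?_
          refine isOpen_lt ?_ continuous_const
          exact ((continuous_apply j).sub continuous_const).norm
        obtain ⟨s, hs, hsU⟩ := hS d le_rfl α _ hU ⟨m, by intro j; simpa using hε⟩
        refine Set.mem_iUnion.2 ⟨⟨s, hs⟩, ?_⟩
        intro j
        have := hsU j
        rw [sub_smul]
        exact this)
    refine ⟨Subtype.val '' (t : Set S), ?_, t.finite_toSet.image _, ?_⟩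
    · rintro _ ⟨s, _, rfl⟩
      exact s.2
    · intro α
      have h := ht (Set.mem_univ α)
      simp only [Set.mem_iUnion] at h
      obtain ⟨s, hs, h⟩ := h
      exact ⟨(s : ℤ) - m, ⟨s, ⟨s, hs, rfl⟩, rfl⟩, h⟩
  choose T hTS hTf hT using key
  refine ⟨⋃ m ∈ Set.Icc (-(M : ℤ)) M, T m, ?_, ?_, ?_⟩
  · exact Set.iUnion₂_subset fun m _ => hTS m
  · exact (Set.finite_Icc _ _).biUnion fun m _ => hTf m
  · intro m hm α
    obtain ⟨_, ⟨s, hs, rfl⟩, h⟩ := hT m α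
    exact ⟨s - m, ⟨s, Set.mem_biUnion (abs_le.1 hm) hs, rfl⟩, h⟩
end

section
/- Let (S_n)_{n∈ℕ} be a sequence of subsets of ℤ, each dense in the Bohr topology of ℤ. Then there is a sequence of finite sets R_n ⊆ S_n such that ⋃_{n∈ℕ} R_n is dense in the Bohr topology of ℤ. -/
open Filter

lemma bohr_nhds (m : ℤ) : @nhds ℤ bohrTopology m =
    ⨅ φ : ℤ →+ AddCircle (1 : ℝ), comap φ (nhds (φ m)) := by
  unfold bohrTopology
  rw [nhds_iInf]
  simp only [nhds_induced]

lemma bohr_fwd {S : Set ℤ} (hS : BohrDense S) (m : ℤ) (d k : ℕ)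
    (α : Fin d → AddCircle (1 : ℝ)) :
    ∃ s ∈ S, ∀ i, dist (s • α i) (m • α i) < 1 / ((k : ℝ) + 1) := by
  have h1 : {s : ℤ | ∀ i, dist (s • α i) (m • α i) < 1 / ((k : ℝ) + 1)} ∈
      @nhds ℤ bohrTopology m := by
    rw [bohr_nhds, Set.ofPred_forall]
    refine (Filter.iInter_mem).2 fun i => ?_
    refine Filter.mem_iInf_of_mem (zmultiplesHom _ (α i)) ?_
    refine ⟨Metric.ball (m • α i) (1 / ((k : ℝ) + 1)), ?_, ?_⟩
    · exact Metric.ball_mem_nhds _ (by positivity)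
    · intro s hs
      simpa using hs
  obtain ⟨s, hs, hs'⟩ := (@mem_closure_iff_nhds ℤ bohrTopology m S).1 (hS m) _ h1
  exact ⟨s, hs', hs⟩

lemma bohr_bwd {S : Set ℤ} (h : ∀ (m : ℤ) (d k : ℕ) (α : Fin d → AddCircle (1 : ℝ)),
    ∃ s ∈ S, ∀ i, dist (s • α i) (m • α i) < 1 / ((k : ℝ) + 1)) : BohrDense S := by
  intro m
  refine (@mem_closure_iff_nhds ℤ bohrTopology m S).2 fun t ht => ?_
  rw [bohr_nhds] at ht
  obtain ⟨⟨I, f⟩, ⟨hI, hf⟩, hsub⟩ := (Filter.HasBasis.iInf' (fun φ : ℤ →+ AddCircle (1 : ℝ) =>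
    (Metric.nhds_basis_ball (x := φ m)).comap φ)).mem_iff.1 ht
  have hev : ∀ᶠ k : ℕ in atTop, ∀ φ ∈ I, 1 / ((k : ℝ) + 1) < f φ := by
    rw [eventually_all_finite hI]
    intro φ hφ
    exact tendsto_one_div_add_atTop_nhds_zero_nat.eventually (gt_mem_nhds (hf φ hφ))
  obtain ⟨k, hk⟩ := hev.exists
  have := hI.fintype
  let e := Fintype.equivFin I
  obtain ⟨s, hs, hs'⟩ := h m (Fintype.card I) k (fun i => (e.symm i).1 1)
  refine ⟨s, hsub ?_, hs⟩
  simp only [Set.mem_iInter]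
  intro φ hφ
  have := hs' (e ⟨φ, hφ⟩)
  simp only [Equiv.symm_apply_apply, ← map_zsmul, smul_eq_mul, mul_one] at this
  exact this.trans (hk φ hφ)

lemma bohr_fin {S : Set ℤ} (hS : BohrDense S) (m : ℤ) (d k : ℕ) :
    ∃ R : Set ℤ, R ⊆ S ∧ R.Finite ∧ ∀ α : Fin d → AddCircle (1 : ℝ),
      ∃ s ∈ R, ∀ i, dist (s • α i) (m • α i) < 1 / ((k : ℝ) + 1) := by
  haveI : Fact ((0 : ℝ) < 1) := ⟨one_pos⟩
  obtain ⟨R, hR, hfin, hc⟩ := (isCompact_univ (X := Fin d → AddCircle (1 : ℝ))).elim_finite_subcover_image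
    (b := S) (c := fun s => {α | ∀ i, dist (s • α i) (m • α i) < 1 / ((k : ℝ) + 1)})
    (fun s _ => by
      rw [Set.ofPred_forall]
      refine isOpen_iInter_of_finite fun i => isOpen_lt ?_ continuous_const
      fun_prop)
    (fun α _ => by
      obtain ⟨s, hs, h⟩ := bohr_fwd hS m d k α
      exact Set.mem_biUnion hs h)
  refine ⟨R, hR, hfin, fun α => ?_⟩
  simpa using hc (Set.mem_univ α)

theorem stmt8 (S : ℕ → Set ℤ) (hS : ∀ n, BohrDense (S n)) :
    ∃ R : ℕ → Set ℤ, (∀ n, R n ⊆ S n) ∧ (∀ n, (R n).Finite) ∧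
      BohrDense (⋃ n, R n) := by
  obtain ⟨e, he⟩ := exists_surjective_nat (ℤ × ℕ × ℕ)
  choose R h1 h2 h3 using fun n => bohr_fin (hS n) (e n).1 (e n).2.1 (e n).2.2
  refine ⟨R, h1, h2, bohr_bwd fun m d k α => ?_⟩
  obtain ⟨n, hn⟩ := he (m, d, k)
  have := h3 n
  rw [hn] at this
  obtain ⟨s, hs, h⟩ := this α
  exact ⟨s, Set.mem_iUnion.2 ⟨n, hs⟩, h⟩
end

section
/- Let k < d ∈ ℕ and ε > 0, and let BH := BH(α; k, ε) be a proper Bohr–Hamming ball of rank d and radius (k, ε). Then BH is k-Bohr dense; furthermore, if S ⊆ ℤ is d-Bohr dense and m ∈ ℤ, then S ∩ (BH + m) is k-Bohr dense. -/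
open Filter Pointwise

/-- The Bohr–Hamming ball `BH(α; k, ε)`: the set of `n ∈ ℤ` such that at most `k`
coordinates of `nα` differ from `0` by at least `ε`. -/
noncomputable def bohrHamming {d : ℕ} (α : Fin d → AddCircle (1 : ℝ)) (k : ℕ) (ε : ℝ) :
    Set ℤ :=
  {n : ℤ | Set.ncard {j : Fin d | ε ≤ ‖(n • α) j‖} ≤ k}

open UnitAddTorus in
lemma kron_mF {N : ℕ} (a : Fin N → ℤ) (x : Fin N → AddCircle (1:ℝ)) :
    mFourier a x = (AddCircle.toCircle (∑ i, a i • x i) : ℂ) := by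
  have h : ∀ s : Finset (Fin N), ∏ i ∈ s, (AddCircle.toCircle (a i • x i) : ℂ) =
      (AddCircle.toCircle (∑ i ∈ s, a i • x i) : ℂ) := by
    intro s
    induction s using Finset.induction_on with
    | empty => simp
    | insert i s hi ih =>
      rw [Finset.prod_insert hi, Finset.sum_insert hi, ih, AddCircle.toCircle_add, Circle.coe_mul]
  exact h Finset.univ

open UnitAddTorus in
lemma kron {N : ℕ} (x y : Fin N → AddCircle (1:ℝ))
    (h : ∀ a : Fin N → ℤ, ∑ i, a i • x i = 0 → ∑ i, a i • y i = 0) :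
    y ∈ closure (Set.range fun n : ℤ => n • x) := by
  have hH : (Set.range fun n : ℤ => n • x) = (AddSubgroup.zmultiples x : Set _) := by
    ext z; simp [AddSubgroup.mem_zmultiples_iff]
  rw [hH, ← AddSubgroup.topologicalClosure_coe]
  set H := (AddSubgroup.zmultiples x).topologicalClosure with hHdef
  have hHc : IsClosed (H : Set (Fin N → AddCircle (1:ℝ))) :=
    AddSubgroup.isClosed_topologicalClosure _
  have hx : ∀ n : ℕ, n • x ∈ H := fun n =>
    AddSubgroup.le_topologicalClosure _ (nsmul_mem (AddSubgroup.mem_zmultiples x) n)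
  by_contra hy
  have hy' : y ∉ H := hy
  have hc2 : IsClosed ((fun z => z - y) ⁻¹' (H : Set (Fin N → AddCircle (1:ℝ)))) :=
    hHc.preimage (by fun_prop)
  obtain ⟨f, hf0, hf1, -⟩ := exists_continuous_zero_one_of_isClosed hHc hc2 (by
    rw [Set.disjoint_left]
    intro z hz hz2
    apply hy'
    have := H.sub_mem hz hz2
    simpa using this)
  let g : C(UnitAddTorus (Fin N), ℂ) := ⟨fun z => (f z : ℂ), by fun_prop⟩
  have key : ∀ p ∈ Submodule.span ℂ (Set.range (mFourier (d := Fin N))),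
      ∃ C : ℝ, ∀ n : ℕ, ‖∑ i ∈ Finset.range n, (p (i • x + y) - p (i • x))‖ ≤ C := by
    intro p hp
    induction hp using Submodule.span_induction with
    | zero => exact ⟨0, by simp⟩
    | add p q _ _ hp hq =>
      obtain ⟨C, hC⟩ := hp
      obtain ⟨D, hD⟩ := hq
      refine ⟨C + D, fun n => ?_⟩
      refine le_trans (le_of_eq ?_) ((norm_add_le _ _).trans (add_le_add (hC n) (hD n)))
      rw [← Finset.sum_add_distrib]
      congr 1
      refine Finset.sum_congr rfl fun i _ => ?_
      simp only [ContinuousMap.add_apply]; ring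
    | smul c p _ hp =>
      obtain ⟨C, hC⟩ := hp
      refine ⟨‖c‖ * C, fun n => ?_⟩
      refine le_trans (le_of_eq ?_) (mul_le_mul_of_nonneg_left (hC n) (norm_nonneg c))
      rw [← norm_mul, Finset.mul_sum]
      congr 1
      refine Finset.sum_congr rfl fun i _ => ?_
      simp only [ContinuousMap.smul_apply, smul_eq_mul]; ring
    | mem p hp =>
      obtain ⟨a, rfl⟩ := hp
      have e1 : ∀ i : ℕ, mFourier a (i • x) = mFourier a x ^ i := by
        intro i
        rw [kron_mF, kron_mF, ← Circle.coe_pow, ← AddCircle.toCircle_nsmul, Finset.smul_sum]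
        simp only [Pi.smul_apply, smul_comm _ i]
      have e2 : ∀ z, mFourier a (z + y) = mFourier a z * mFourier a y := by
        intro z
        rw [kron_mF, kron_mF, kron_mF, ← Circle.coe_mul, ← AddCircle.toCircle_add,
          ← Finset.sum_add_distrib]
        simp only [Pi.add_apply, smul_add]
      simp only [e1, e2]
      by_cases hz : mFourier a x = 1
      · have : mFourier a y = 1 := by
          rw [kron_mF] at hz ⊢
          have h0 : ∑ i, a i • x i = 0 := by
            apply AddCircle.injective_toCircle (one_ne_zero)
            rw [AddCircle.toCircle_zero]
            exact Circle.ext hz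
          rw [h a h0]; simp
        exact ⟨0, by simp [this]⟩
      · have hn : ∀ z, ‖mFourier a z‖ = 1 := fun z => by
          rw [kron_mF]; exact Circle.norm_coe _
        refine ⟨2 / ‖mFourier a x - 1‖ * 2, fun n => ?_⟩
        have : ∑ i ∈ Finset.range n, (mFourier a x ^ i * mFourier a y - mFourier a x ^ i)
          = (mFourier a x ^ n - 1) / (mFourier a x - 1) * (mFourier a y - 1) := by
          rw [← geom_sum_eq hz, Finset.sum_mul]
          exact Finset.sum_congr rfl fun i _ => by ring
        rw [this, norm_mul, norm_div]
        gcongr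
        · refine (norm_sub_le _ _).trans ?_
          rw [norm_pow, hn]; norm_num
        · refine (norm_sub_le _ _).trans ?_
          rw [hn]; norm_num
  have hg : g ∈ closure (Submodule.span ℂ (Set.range (mFourier (d := Fin N))) : Set C(UnitAddTorus (Fin N), ℂ)) := by
    rw [← Submodule.topologicalClosure_coe, span_mFourier_closure_eq_top]; trivial
  obtain ⟨p, hp, hpg⟩ := Metric.mem_closure_iff.1 hg (1/4) (by norm_num)
  obtain ⟨C, hC⟩ := key p hp
  have hd : ∀ z, ‖g z - p z‖ ≤ 1/4 := fun z => by
    rw [← dist_eq_norm]; exact (ContinuousMap.dist_apply_le_dist z).trans hpg.le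
  have hterm : ∀ i : ℕ, ‖1 - (p (i • x + y) - p (i • x))‖ ≤ 1/2 := by
    intro i
    have g0 : g (i • x) = 0 := by simp [g, hf0 (hx i)]
    have g1 : g (i • x + y) = 1 := by
      have : f (i • x + y) = 1 := hf1 (by simpa using hx i)
      simp [g, this]
    have := norm_sub_le (g (i • x + y) - p (i • x + y)) (g (i • x) - p (i • x))
    have h1 := hd (i • x + y)
    have h2 := hd (i • x)
    rw [show 1 - (p (i • x + y) - p (i • x)) = (g (i • x + y) - p (i • x + y)) - (g (i • x) - p (i • x)) by
      rw [g0, g1]; ring]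
    linarith
  obtain ⟨n, hn⟩ := exists_nat_gt (2 * C)
  have h1 : ‖∑ i ∈ Finset.range n, (1 - (p (i • x + y) - p (i • x)))‖ ≤ n * (1/2) := by
    refine (norm_sum_le_of_le _ fun i _ => hterm i).trans ?_
    simp
  rw [Finset.sum_sub_distrib] at h1
  have h2 := hC n
  have h3 := norm_sub_norm_le (∑ i ∈ Finset.range n, (1:ℂ)) (∑ i ∈ Finset.range n, (p (i • x + y) - p (i • x)))
  have h4 : ‖∑ i ∈ Finset.range n, (1:ℂ)‖ = n := by simp
  linarith

lemma indep_of_dense {d : ℕ} (α : Fin d → AddCircle (1 : ℝ))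
    (hα : Dense (Set.range fun n : ℤ => n • α)) (b : Fin d → ℤ)
    (hb : ∑ j, b j • α j = 0) : b = 0 := by
  have hc : IsClosed {x : Fin d → AddCircle (1:ℝ) | ∑ j, b j • x j = 0} :=
    isClosed_eq (by fun_prop) continuous_const
  have hall : ∀ x : Fin d → AddCircle (1:ℝ), ∑ j, b j • x j = 0 := by
    intro x
    have : closure (Set.range fun n : ℤ => n • α) ⊆ {x | ∑ j, b j • x j = 0} := by
      refine closure_minimal ?_ hc
      rintro _ ⟨n, rfl⟩
      have : ∑ j, b j • (n • α) j = n • ∑ j, b j • α j := by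
        rw [Finset.smul_sum]; simp only [Pi.smul_apply, smul_comm _ n]
      simp only [Set.mem_ofPred_eq]
      rw [this, hb, smul_zero]
    exact this (hα x)
  ext j
  by_contra hj
  have hj' : ((b j : ℤ) : ℝ) ≠ 0 := by exact_mod_cast hj
  have := hall (Pi.single j ((1 / (2 * (b j : ℝ)) : ℝ) : AddCircle (1:ℝ)))
  rw [Finset.sum_eq_single j (by intro i _ hi; simp [hi]) (by simp)] at this
  rw [Pi.single_eq_same, ← AddCircle.coe_zsmul, AddCircle.coe_eq_zero_iff] at this
  obtain ⟨n, hn⟩ := this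
  simp only [zsmul_eq_mul, mul_one] at hn
  have h2 : (2 * n : ℝ) = 1 := by rw [hn]; field_simp
  have : (2 * n : ℤ) = 1 := by exact_mod_cast h2
  omega

lemma exchange {d e k : ℕ} (hek : e ≤ k) (α : Fin d → AddCircle (1 : ℝ))
    (hα : ∀ b : Fin d → ℤ, ∑ j, b j • α j = 0 → b = 0) (β : Fin e → AddCircle (1 : ℝ)) :
    ∃ c : Fin (d - k) → Fin d, Function.Injective c ∧
      ∀ (p : Fin e → ℤ) (q : Fin (d - k) → ℤ),
        ∑ i, p i • β i + ∑ j, q j • α (c j) = 0 → q = 0 := by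
  have hs : ∀ t : AddCircle (1:ℝ), ∃ r : ℝ, (r : AddCircle (1:ℝ)) = t :=
    QuotientAddGroup.mk_surjective
  choose a ha using fun j => hs (α j)
  choose b hb using fun j => hs (β j)
  have hlin : LinearIndependent ℚ (fun o : Option (Fin d) => o.elim (1:ℝ) a) := by
    rw [← LinearIndependent.iff_fractionRing ℤ ℚ, Fintype.linearIndependent_iff]
    intro g hg
    rw [Fintype.sum_option] at hg
    simp only [Option.elim] at hg
    have h0 : (fun j => g (some j)) = 0 := by
      apply hα
      have h1 : ((∑ j, g (some j) • a j : ℝ) : AddCircle (1:ℝ)) = 0 := by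
        rw [AddCircle.coe_eq_zero_iff]
        exact ⟨- g none, by rw [neg_smul]; linarith⟩
      rw [← h1, ← QuotientAddGroup.mk'_apply, map_sum]
      exact Finset.sum_congr rfl fun j _ => by rw [map_zsmul, QuotientAddGroup.mk'_apply, ha]
    have h0' : ∀ j, g (some j) = 0 := fun j => congrFun h0 j
    intro i
    cases i with
    | none => simpa [h0'] using hg
    | some j => exact h0' j
  let w : Option (Fin e) → ℝ := fun o => o.elim (1:ℝ) b
  let P : Submodule ℚ ℝ := Submodule.span ℚ (Set.range w)
  obtain ⟨κ, c, hc, hspan, hli⟩ := exists_linearIndependent' ℚ (fun j => P.mkQ (a j))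
  have : Finite κ := Finite.of_injective c hc
  have := Fintype.ofFinite κ
  have hcard : d - k ≤ Fintype.card κ := by
    let Q : Submodule ℚ ℝ := Submodule.span ℚ (Set.range (Sum.elim w (a ∘ c)))
    have hPQ : P ≤ Q := Submodule.span_mono (by rintro _ ⟨i, rfl⟩; exact ⟨Sum.inl i, rfl⟩)
    have hQ : Submodule.span ℚ (Set.range (fun o : Option (Fin d) => o.elim (1:ℝ) a)) ≤ Q := by
      rw [Submodule.span_le]
      rintro _ ⟨o, rfl⟩
      cases o with
      | none => exact Submodule.subset_span ⟨Sum.inl none, rfl⟩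
      | some j =>
        have h1 : P.mkQ (a j) ∈ Submodule.span ℚ (Set.range ((fun j => P.mkQ (a j)) ∘ c)) := by
          rw [hspan]; exact Submodule.subset_span ⟨j, rfl⟩
        have h2 : Set.range ((fun j => P.mkQ (a j)) ∘ c) = P.mkQ '' Set.range (a ∘ c) := by
          rw [← Set.range_comp]; rfl
        rw [h2, ← Submodule.map_span] at h1
        obtain ⟨z, hz, hz2⟩ := h1
        have h3 : a j - z ∈ P := by
          rw [← Submodule.ker_mkQ P, LinearMap.mem_ker, map_sub, hz2, sub_self]
        have h4 : z ∈ Q := Submodule.span_mono (by rintro _ ⟨i, rfl⟩; exact ⟨Sum.inr i, rfl⟩) hz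
        have := Q.add_mem (hPQ h3) h4
        simpa using this
    have : FiniteDimensional ℚ Q := FiniteDimensional.span_of_finite ℚ (Set.finite_range _)
    have h1 := Submodule.finrank_mono hQ
    rw [finrank_span_eq_card hlin] at h1
    have h2 : Module.finrank ℚ Q ≤ _ := finrank_range_le_card (R := ℚ) (Sum.elim w (a ∘ c))
    simp at h1 h2
    omega
  let E : Fin (d - k) → κ := fun i => (Fintype.equivFin κ).symm (Fin.castLE hcard i)
  have hE : Function.Injective E :=
    (Fintype.equivFin κ).symm.injective.comp (Fin.castLE_injective hcard)
  refine ⟨c ∘ E, hc.comp hE, fun p q hpq => ?_⟩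
  have hl := hli.comp E hE
  rw [Fintype.linearIndependent_iff] at hl
  have h1 : ((∑ i, p i • b i + ∑ j, q j • a (c (E j)) : ℝ) : AddCircle (1:ℝ)) = 0 := by
    rw [← hpq, ← QuotientAddGroup.mk'_apply, map_add, map_sum, map_sum]
    congr 1
    · exact Finset.sum_congr rfl fun j _ => by rw [map_zsmul, QuotientAddGroup.mk'_apply, hb]
    · exact Finset.sum_congr rfl fun j _ => by
        rw [map_zsmul, QuotientAddGroup.mk'_apply, ha]; rfl
  rw [AddCircle.coe_eq_zero_iff] at h1
  obtain ⟨n, hn⟩ := h1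
  have hmem : ∑ j, q j • a (c (E j)) ∈ P := by
    have : ∑ j, q j • a (c (E j)) = n • w none - ∑ i, p i • w (some i) := by
      simp only [w, Option.elim]; rw [hn]; ring
    rw [this]
    have hw : ∀ o, w o ∈ P := fun o => Submodule.subset_span ⟨o, rfl⟩
    exact P.sub_mem (zsmul_mem (hw _) _) (P.sum_mem fun i _ => zsmul_mem (hw _) _)
  have h2 := hl (fun j => (q j : ℚ)) (by
    rw [← Submodule.ker_mkQ P, LinearMap.mem_ker, map_sum] at hmem
    rw [← hmem]
    refine Finset.sum_congr rfl fun j _ => ?_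
    rw [map_zsmul, Int.cast_smul_eq_zsmul]; rfl)
  ext j
  exact_mod_cast h2 j

lemma main_part (k d : ℕ) (hkd : k < d) (ε : ℝ) (hε : 0 < ε)
    (α : Fin d → AddCircle (1 : ℝ))
    (hα : Dense (Set.range fun n : ℤ => n • α)) (S : Set ℤ) (hS : BohrDenseRank d S) (m : ℤ) :
    BohrDenseRank k (S ∩ ((fun n => n + m) '' bohrHamming α k ε)) := by
  intro e he β U hU ⟨n0, hn0⟩
  obtain ⟨c, hc, hci⟩ := exchange he α (indep_of_dense α hα) β
  let γ : Fin (e + (d - k)) → AddCircle (1:ℝ) := Fin.append β (α ∘ c)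
  let y : Fin (e + (d - k)) → AddCircle (1:ℝ) := Fin.append (n0 • β) (m • (α ∘ c))
  let V : Set (Fin (e + (d - k)) → AddCircle (1:ℝ)) :=
    {x | (fun i => x (Fin.castAdd _ i)) ∈ U} ∩ ⋂ j, {x | ‖x (Fin.natAdd e j) - m • α (c j)‖ < ε}
  have hV : IsOpen V := by
    refine IsOpen.inter (hU.preimage (by fun_prop)) (isOpen_iInter_of_finite fun j => ?_)
    exact isOpen_lt (by fun_prop) continuous_const
  have hyV : y ∈ V := by
    refine ⟨?_, ?_⟩
    · have : (fun i => y (Fin.castAdd _ i)) = n0 • β := by ext i; simp [y]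
      simpa only [Set.mem_ofPred_eq, this] using hn0
    · simp [y, hε]
  have hcl := kron γ y (by
    intro p hp
    rw [Fin.sum_univ_add] at hp ⊢
    simp only [γ, y, Fin.append_left, Fin.append_right, Function.comp, Pi.smul_apply] at hp ⊢
    have h0 := hci _ _ hp
    have h0' : ∀ j, p (Fin.natAdd e j) = 0 := fun j => congrFun h0 j
    simp only [h0', zero_smul, Finset.sum_const_zero, add_zero] at hp ⊢
    simp only [smul_comm _ n0, ← Finset.smul_sum, hp, smul_zero])
  obtain ⟨_, hnV, n, rfl⟩ := mem_closure_iff.1 hcl V hV hyV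
  obtain ⟨s, hsS, hsU, hsV⟩ := hS _ (by omega) γ V hV ⟨n, hnV⟩
  refine ⟨s, ⟨hsS, s - m, ?_, by simp⟩, ?_⟩
  · have hsub : {j : Fin d | ε ≤ ‖((s - m) • α) j‖} ⊆ (Set.range c)ᶜ := by
      rintro j hj ⟨i, rfl⟩
      have := Set.mem_iInter.1 hsV i
      simp only [Set.mem_ofPred_eq, γ, Pi.smul_apply, Fin.append_right, Function.comp] at this hj
      rw [sub_smul] at hj
      linarith
    refine (Set.ncard_le_ncard hsub).trans ?_
    rw [Set.ncard_compl, ← Set.image_univ, Set.ncard_image_of_injective _ hc]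
    simp
    omega
  · have : (fun i => (s • γ) (Fin.castAdd _ i)) = s • β := by ext i; simp [γ]
    rw [← this]; exact hsU

theorem stmt9 (k d : ℕ) (hkd : k < d) (ε : ℝ) (hε : 0 < ε)
    (α : Fin d → AddCircle (1 : ℝ))
    (hα : Dense (Set.range fun n : ℤ => n • α)) :
    BohrDenseRank k (bohrHamming α k ε) ∧
      ∀ S : Set ℤ, BohrDenseRank d S → ∀ m : ℤ,
        BohrDenseRank k (S ∩ ((fun n => n + m) '' bohrHamming α k ε)) := by
  refine ⟨?_, main_part k d hkd ε hε α hα⟩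
  have h := main_part k d hkd ε hε α hα Set.univ
    (fun e _ β U _ ⟨n, hn⟩ => ⟨n, trivial, hn⟩) 0
  simpa using h
end
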